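/- arXiv:1811.06718 — 2 statements merged into one kernel-verified Lean document; each statement's English description precedes it below -/
import Mathlib

section
/- Let T be an ABC-tile having exactly 14 neighbors and let α, β ∈ ℤ³ \ {0} be distinct with T ∩ (T + α) ∩ (T + β) ≠ ∅. Then the set of points x ∈ T ∩ (T + α) ∩ (T + β) for which there exists γ ∈ ℤ³ with γ ∉ {0, α, β} and x ∈ T + γ has exactly two elements. -/
open MeasureTheory

noncomputable def Mmat (A B C : ℤ) : Matrix (Fin 3) (Fin 3) ℝ :=
  !![0, 0, -(C : ℝ); 1, 0, -(B : ℝ); 0, 1, -(A : ℝ)]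

def Ddig (C : ℤ) : Set (Fin 3 → ℝ) :=
  {d | ∃ i : ℤ, 0 ≤ i ∧ i < C ∧ d = ![(i : ℝ), 0, 0]}

def toR (α : Fin 3 → ℤ) : Fin 3 → ℝ := fun i => (α i : ℝ)

def tileTranslate (v : Fin 3 → ℝ) (T : Set (Fin 3 → ℝ)) : Set (Fin 3 → ℝ) :=
  (fun x => x + v) '' T

def IsABCTile (A B C : ℤ) (T : Set (Fin 3 → ℝ)) : Prop :=
  1 ≤ A ∧ A ≤ B ∧ B < C ∧
  T.Nonempty ∧ IsCompact T ∧ 0 < volume T ∧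
  (Mmat A B C).mulVec '' T = ⋃ d ∈ Ddig C, tileTranslate d T

def Neighbors (T : Set (Fin 3 → ℝ)) : Set (Fin 3 → ℤ) :=
  {α | α ≠ 0 ∧ (T ∩ tileTranslate (toR α) T).Nonempty}


abbrev Z3 := ℤ × ℤ × ℤ

/-- The action of `Mmat` written in coordinates. -/
def Mm (A B C : ℤ) (y : Fin 3 → ℝ) : Fin 3 → ℝ :=
  ![-(C : ℝ) * y 2, y 0 - B * y 2, y 1 - A * y 2]

def dv (d : ℤ) : Fin 3 → ℝ := ![(d : ℝ), 0, 0]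

/-- Convenient coordinates on the lattice: neighbors become `±{0,1}^3`. -/
def Vz (A B : ℤ) (s : Z3) : Fin 3 → ℤ :=
  ![s.2.2 - s.2.1 + B * s.1 + A * (s.2.1 - s.1), s.2.1 - s.1 + A * s.1, s.1]

def Vr (A B : ℤ) (s : Z3) : Fin 3 → ℝ := toR (Vz A B s)

def phi (s : Z3) : Z3 := (s.2.1 - s.1, s.2.2 - s.1, -s.1)

def LL (A B C : ℤ) (s : Z3) : ℤ := (A - 1) * s.2.2 + (B - A) * s.2.1 + (C - B) * s.1

def NN (s : Z3) : Prop :=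
  (0 ≤ s.1 ∧ s.1 ≤ 1 ∧ 0 ≤ s.2.1 ∧ s.2.1 ≤ 1 ∧ 0 ≤ s.2.2 ∧ s.2.2 ≤ 1) ∨
  (-1 ≤ s.1 ∧ s.1 ≤ 0 ∧ -1 ≤ s.2.1 ∧ s.2.1 ≤ 0 ∧ -1 ≤ s.2.2 ∧ s.2.2 ≤ 0)

instance : DecidablePred NN := fun s => by unfold NN; infer_instance

theorem Mm_eq (A B C : ℤ) (y : Fin 3 → ℝ) : (Mmat A B C).mulVec y = Mm A B C y := by
  ext i
  fin_cases i <;> simp [Mmat, Mm, Matrix.mulVec, dotProduct, Fin.sum_univ_three] <;> ring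

theorem Mm_sub (A B C : ℤ) (x y : Fin 3 → ℝ) :
    Mm A B C (x - y) = Mm A B C x - Mm A B C y := by
  ext i
  fin_cases i <;> simp [Mm] <;> ring

theorem Vr_sub (A B : ℤ) (s t : Z3) : Vr A B (s - t) = Vr A B s - Vr A B t := by
  ext i
  fin_cases i <;> simp [Vr, Vz, toR] <;> ring

theorem Vr_zero (A B : ℤ) : Vr A B 0 = 0 := by
  ext i
  fin_cases i <;> simp [Vr, Vz, toR]

theorem Vz_inj (A B : ℤ) : Function.Injective (Vz A B) := by
  rintro ⟨a, b, c⟩ ⟨a', b', c'⟩ h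
  have h0 := congrFun h 0
  have h1 := congrFun h 1
  have h2 := congrFun h 2
  simp [Vz] at h0 h1 h2
  subst h2
  have : b = b' := by linarith
  subst this
  have : c = c' := by linarith
  subst this
  rfl

theorem Vz_surj (A B : ℤ) (α : Fin 3 → ℤ) : ∃ s, Vz A B s = α := by
  refine ⟨(α 2, α 1 - A * α 2 + α 2,
    α 0 + (α 1 - A * α 2 + α 2) - B * α 2 - A * (α 1 - A * α 2)), ?_⟩
  ext i
  fin_cases i
  · simp [Vz]; ring
  · simp [Vz]
  · simp [Vz]

theorem Vz_zero (A B : ℤ) : Vz A B 0 = 0 := by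
  ext i
  fin_cases i <;> simp [Vz]

theorem Mm_Vr (A B C : ℤ) (s : Z3) (e : ℤ) :
    Mm A B C (Vr A B s) + dv e = Vr A B (phi s + (0, 0, e - LL A B C s)) := by
  ext i
  fin_cases i <;> simp [Mm, Vr, Vz, toR, dv, phi, LL] <;> ring

theorem dv_sub (d e : ℤ) : dv (d - e) = dv d - dv e := by
  ext i
  fin_cases i <;> simp [dv]

/-- The matrix is expanding: a bounded forward orbit vanishes (scalar recurrence form). -/
theorem expand_aux (A B C : ℤ) (hA : 1 ≤ A) (hAB : A ≤ B) (hBC : B < C) (r : ℕ → ℝ)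
    (hr : ∀ n, r (n + 3) + A * r (n + 2) + B * r (n + 1) + C * r n = 0)
    (S : ℝ) (hS : ∀ n, |r n| ≤ S) (n : ℕ) : r n ≤ (1 - 1 / (C : ℝ) ^ 3) * S := by
  have hA' : (1 : ℝ) ≤ A := by exact_mod_cast hA
  have hAB' : (A : ℝ) ≤ B := by exact_mod_cast hAB
  have hBC' : (B : ℝ) + 1 ≤ C := by exact_mod_cast hBC
  have hC1 : (1 : ℝ) ≤ C := by linarith
  have hC0 : (0 : ℝ) < C := by linarith
  have hS0 : 0 ≤ S := (abs_nonneg _).trans (hS 0)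
  have hle : ∀ n, r n ≤ S := fun n => (le_abs_self _).trans (hS n)
  have back : ∀ n, ∀ t : ℝ, 0 ≤ t → r (n + 1) ≤ S - t → r n ≤ S - t / C := by
    intro n t ht h
    have e1 := hr n
    have e2 := hr (n + 1)
    have e : C * r n = (C - B) * r (n + 1) + (B - A) * r (n + 2) + (A - 1) * r (n + 3)
        + r (n + 4) := by
      have e3 : r (n + 4) + A * r (n + 3) + B * r (n + 2) + C * r (n + 1) = 0 := e2
      linarith
    have i1 : ((C : ℝ) - B) * r (n + 1) ≤ (C - B) * (S - t) :=
      mul_le_mul_of_nonneg_left h (by linarith)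
    have i2 : ((B : ℝ) - A) * r (n + 2) ≤ (B - A) * S :=
      mul_le_mul_of_nonneg_left (hle _) (by linarith)
    have i3 : ((A : ℝ) - 1) * r (n + 3) ≤ (A - 1) * S :=
      mul_le_mul_of_nonneg_left (hle _) (by linarith)
    have i4 := hle (n + 4)
    have i5 : t ≤ ((C : ℝ) - B) * t := by nlinarith
    have : C * r n ≤ C * S - t := by nlinarith
    have h' : r n ≤ (C * S - t) / C := by
      rw [le_div_iff₀ hC0]; linarith
    have : (C * S - t) / C = S - t / C := by field_simp
    linarith
  have weak : ∀ t t' : ℝ, t' ≤ t → ∀ x, x ≤ S - t → x ≤ S - t' := by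
    intros; linarith
  have q1 : S / C ≤ S := div_le_self hS0 hC1
  have q2 : S / C / C ≤ S / C := div_le_self (by positivity) hC1
  have q3 : S / C / C / C ≤ S / C / C := div_le_self (by positivity) hC1
  have key : r n ≤ S - S / C / C / C := by
    by_cases h0 : r n ≤ 0
    · linarith
    by_cases h1 : r (n + 1) ≤ 0
    · have := back n S hS0 (by linarith)
      linarith
    by_cases h2 : r (n + 2) ≤ 0
    · have := back (n + 1) S hS0 (by show r (n + 2) ≤ _; linarith)
      have := back n _ (by positivity) this
      linarith
    by_cases h3 : r (n + 3) ≤ 0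
    · have := back (n + 2) S hS0 (by show r (n + 3) ≤ _; linarith)
      have := back (n + 1) _ (by positivity) this
      have := back n _ (by positivity) this
      linarith
    exfalso
    push Not at h0 h1 h2 h3
    have := hr n
    have : (0 : ℝ) < A * r (n + 2) := by apply mul_pos <;> linarith
    have : (0 : ℝ) < B * r (n + 1) := by apply mul_pos <;> linarith
    have : (0 : ℝ) < C * r n := by apply mul_pos <;> linarith
    linarith
  have : (1 - 1 / (C : ℝ) ^ 3) * S = S - S / C / C / C := by field_simp
  linarith

theorem expand (A B C : ℤ) (hA : 1 ≤ A) (hAB : A ≤ B) (hBC : B < C) (r : ℕ → ℝ)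
    (hr : ∀ n, r (n + 3) + A * r (n + 2) + B * r (n + 1) + C * r n = 0)
    (S : ℝ) (hS : ∀ n, |r n| ≤ S) (n : ℕ) : r n = 0 := by
  have hbdd : BddAbove (Set.range fun n => |r n|) := ⟨S, by rintro _ ⟨n, rfl⟩; exact hS n⟩
  set K := ⨆ n, |r n| with hK
  have hKn : ∀ n, |r n| ≤ K := fun n => le_ciSup hbdd n
  have h1 := expand_aux A B C hA hAB hBC r hr K hKn
  have h2 := expand_aux A B C hA hAB hBC (fun n => - r n)
    (fun n => by have := hr n; linarith) K (fun n => by rw [abs_neg]; exact hKn n)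
  have h3 : K ≤ (1 - 1 / (C : ℝ) ^ 3) * K := by
    apply ciSup_le
    intro n
    exact abs_le.mpr ⟨by have := h2 n; linarith, h1 n⟩
  have hC0 : (0 : ℝ) < 1 / (C : ℝ) ^ 3 := by
    have : (0 : ℝ) < C := by exact_mod_cast (by omega : 0 < C)
    positivity
  have : K ≤ 0 := by nlinarith
  have := hKn n
  have := abs_nonneg (r n)
  exact abs_eq_zero.mp (by linarith)

theorem orbit_zero (A B C : ℤ) (hA : 1 ≤ A) (hAB : A ≤ B) (hBC : B < C)
    (z : ℕ → Fin 3 → ℝ) (hz : ∀ n, z (n + 1) = Mm A B C (z n))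
    (S : ℝ) (hS : ∀ n i, |z n i| ≤ S) : z 0 = 0 := by
  have e0 : ∀ n, z (n + 1) 0 = -(C : ℝ) * z n 2 := fun n => by rw [hz]; simp [Mm]
  have e1 : ∀ n, z (n + 1) 1 = z n 0 - B * z n 2 := fun n => by rw [hz]; simp [Mm]
  have e2 : ∀ n, z (n + 1) 2 = z n 1 - A * z n 2 := fun n => by rw [hz]; simp [Mm]
  have h := expand A B C hA hAB hBC (fun n => z n 2)
    (fun n => by
      have a1 := e2 (n + 2)
      have a2 := e1 (n + 1)
      have a3 := e0 n
      show z (n + 2 + 1) 2 + A * z (n + 1 + 1) 2 + B * z (n + 1) 2 + C * z n 2 = 0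
      have b : z (n + 2) 1 = z (n + 1 + 1) 1 := rfl
      have b' : z (n + 2) 2 = z (n + 1 + 1) 2 := rfl
      rw [a1, b, a2, a3, b']
      ring) S (fun n => hS n 2)
  have htwo : ∀ n, z n 2 = 0 := h
  have h1 : ∀ n, z n 1 = 0 := fun n => by have := e2 n; rw [htwo, htwo] at this; linarith
  have h0 : ∀ n, z n 0 = 0 := fun n => by have := e1 n; rw [htwo, h1] at this; linarith
  ext i
  fin_cases i
  · exact h0 0
  · exact h1 0
  · exact htwo 0

/-- Everything we need to know about the tile. -/
structure Good (A B C : ℤ) (T : Set (Fin 3 → ℝ)) : Prop where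
  hA : 1 ≤ A
  hAB : A ≤ B
  hBC : B < C
  ne : T.Nonempty
  cpt : IsCompact T
  step : ∀ y ∈ T, ∃ d : ℤ, 0 ≤ d ∧ d < C ∧ Mm A B C y - dv d ∈ T
  back : ∀ y ∈ T, ∀ d : ℤ, 0 ≤ d → d < C → ∃ x ∈ T, Mm A B C x = y + dv d

theorem good_of_tile {A B C : ℤ} {T : Set (Fin 3 → ℝ)} (h : IsABCTile A B C T) :
    Good A B C T := by
  obtain ⟨hA, hAB, hBC, ne, cpt, _, heq⟩ := h
  refine ⟨hA, hAB, hBC, ne, cpt, ?_, ?_⟩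
  · intro y hy
    have : (Mmat A B C).mulVec y ∈ ⋃ d ∈ Ddig C, tileTranslate d T := by
      rw [← heq]; exact ⟨y, hy, rfl⟩
    simp only [Set.mem_iUnion] at this
    obtain ⟨d, ⟨i, h0, h1, rfl⟩, x, hx, hxy⟩ := this
    refine ⟨i, h0, h1, ?_⟩
    rw [← Mm_eq, ← hxy]
    have : x + ![(i : ℝ), 0, 0] - dv i = x := add_sub_cancel_right _ _
    simpa only [this] using hx
  · intro y hy d h0 h1
    have : y + dv d ∈ ⋃ d ∈ Ddig C, tileTranslate d T := by
      simp only [Set.mem_iUnion]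
      exact ⟨dv d, ⟨d, h0, h1, rfl⟩, y, hy, rfl⟩
    rw [← heq] at this
    obtain ⟨x, hx, hxy⟩ := this
    exact ⟨x, hx, by rw [← Mm_eq]; exact hxy⟩

theorem Good.bdd {A B C : ℤ} {T : Set (Fin 3 → ℝ)} (h : Good A B C T) :
    ∃ K : ℝ, ∀ x ∈ T, ∀ i, |x i| ≤ K := by
  obtain ⟨K, hK⟩ := h.cpt.isBounded.exists_norm_le
  exact ⟨K, fun x hx i => (norm_le_pi_norm x i).trans (hK x hx)⟩

theorem continuous_Mm (A B C : ℤ) : Continuous (Mm A B C) := by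
  have : Mm A B C = fun y => (Mmat A B C).mulVec y := by
    funext y; rw [Mm_eq]
  rw [this]
  exact Continuous.matrix_mulVec continuous_const continuous_id

theorem Good.chain {A B C : ℤ} {T : Set (Fin 3 → ℝ)} (h : Good A B C T) (d : ℕ → ℤ)
    (hd : ∀ n, 0 ≤ d n ∧ d n < C) :
    ∃ X : ℕ → Fin 3 → ℝ, ∀ n, X n ∈ T ∧ X (n + 1) = Mm A B C (X n) - dv (d n) := by
  have fin : ∀ N : ℕ, ∀ d : ℕ → ℤ, (∀ n, 0 ≤ d n ∧ d n < C) →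
      ∃ X : ℕ → Fin 3 → ℝ, (∀ n, X n ∈ T) ∧
        ∀ n < N, X (n + 1) = Mm A B C (X n) - dv (d n) := by
    intro N
    induction N with
    | zero =>
      intro d _
      obtain ⟨x, hx⟩ := h.ne
      exact ⟨fun _ => x, fun _ => hx, fun n hn => absurd hn (by omega)⟩
    | succ N ih =>
      intro d hd
      obtain ⟨X, hX, hX'⟩ := ih (fun n => d (n + 1)) (fun n => hd (n + 1))
      obtain ⟨x, hx, hxe⟩ := h.back (X 0) (hX 0) (d 0) (hd 0).1 (hd 0).2
      refine ⟨fun n => Nat.casesOn n x X, ?_, ?_⟩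
      · intro n
        cases n with
        | zero => exact hx
        | succ n => exact hX n
      · intro n hn
        cases n with
        | zero => show X 0 = _; simp [hxe]
        | succ n => exact hX' n (by omega)
  let F : ℕ → Set (ℕ → Fin 3 → ℝ) := fun N =>
    (Set.univ.pi fun _ => T) ∩ {X | ∀ n < N, X (n + 1) = Mm A B C (X n) - dv (d n)}
  have hK : IsCompact (Set.univ.pi fun _ : ℕ => T) := isCompact_univ_pi fun _ => h.cpt
  have hcl : ∀ N, IsClosed {X : ℕ → Fin 3 → ℝ | ∀ n < N, X (n + 1) = Mm A B C (X n) - dv (d n)} := by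
    intro N
    simp only [Set.ofPred_forall]
    refine isClosed_iInter fun n => isClosed_iInter fun _ => ?_
    exact isClosed_eq (continuous_apply _)
      (((continuous_Mm A B C).comp (continuous_apply n)).sub continuous_const)
  have hne : (⋂ N, F N).Nonempty := by
    apply IsCompact.nonempty_iInter_of_sequence_nonempty_isCompact_isClosed
    · intro N X hX
      exact ⟨hX.1, fun n hn => hX.2 n (by omega)⟩
    · intro N
      obtain ⟨X, hX, hX'⟩ := fin N d hd
      exact ⟨X, fun n _ => hX n, hX'⟩
    · exact hK.inter_right (hcl 0)
    · intro N
      exact hK.isClosed.inter (hcl N)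
  obtain ⟨X, hX⟩ := hne
  rw [Set.mem_iInter] at hX
  exact ⟨X, fun n => ⟨(hX 0).1 n trivial, (hX (n + 1)).2 n (by omega)⟩⟩

/-- Two digit chains whose difference follows a bounded lattice walk. -/
theorem Good.pair {A B C : ℤ} {T : Set (Fin 3 → ℝ)} (h : Good A B C T) (d d' : ℕ → ℤ)
    (X X' : ℕ → Fin 3 → ℝ)
    (hX : ∀ n, X n ∈ T ∧ X (n + 1) = Mm A B C (X n) - dv (d n))
    (hX' : ∀ n, X' n ∈ T ∧ X' (n + 1) = Mm A B C (X' n) - dv (d' n))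
    (s : ℕ → Z3)
    (hs : ∀ n, s (n + 1) = phi (s n) + (0, 0, (d' n - d n) - LL A B C (s n)))
    (K : ℝ) (hK : ∀ n i, |Vr A B (s n) i| ≤ K) : X 0 - X' 0 = Vr A B (s 0) := by
  obtain ⟨R, hR⟩ := h.bdd
  have := orbit_zero A B C h.hA h.hAB h.hBC (fun n => X n - X' n - Vr A B (s n))
    (fun n => by
      show X (n + 1) - X' (n + 1) - Vr A B (s (n + 1)) = Mm A B C (X n - X' n - Vr A B (s n))
      rw [hs n, ← Mm_Vr, (hX n).2, (hX' n).2, Mm_sub, Mm_sub, dv_sub]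
      abel) (R + R + K)
    (fun n i => by
      have h1 := hR _ (hX n).1 i
      have h2 := hR _ (hX' n).1 i
      have h3 := hK n i
      simp only [Pi.sub_apply]
      rw [abs_le] at *
      constructor <;> linarith [h1.1, h1.2, h2.1, h2.2, h3.1, h3.2])
  exact sub_eq_zero.mp this

theorem NN_phi {s : Z3} (h : NN s) : NN (phi s) := by
  simp only [NN, phi] at *
  omega

theorem NN_neg {s : Z3} (h : NN s) : NN (-s) := by
  simp only [NN, Prod.fst_neg, Prod.snd_neg] at *
  omega

theorem LL_sub (A B C : ℤ) (s t : Z3) : LL A B C (s - t) = LL A B C s - LL A B C t := by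
  simp [LL]; ring

theorem phi_sub (s t : Z3) : phi (s - t) = phi s - phi t := by
  ext <;> simp [phi] <;> ring

theorem phi_inj : Function.Injective phi := by
  rintro ⟨a, b, c⟩ ⟨a', b', c'⟩ h
  simp only [phi, Prod.mk.injEq] at h ⊢
  omega

theorem LL_bound {A B C : ℤ} (hA : 1 ≤ A) (hAB : A ≤ B) (hBC : B < C) {s : Z3} (h : NN s) :
    LL A B C s ≤ C - 1 ∧ -(C - 1) ≤ LL A B C s := by
  obtain ⟨a, b, c⟩ := s
  simp only [NN, LL] at *
  rcases h with h | h <;> obtain ⟨h1, h2, h3, h4, h5, h6⟩ := h <;> constructor <;> nlinarith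

theorem Vr_bound (A B : ℤ) (s : Z3) (k : ℤ) (h1 : |s.1| ≤ k) (h2 : |s.2.1| ≤ k)
    (h3 : |s.2.2| ≤ k) (i : Fin 3) :
    |Vr A B s i| ≤ ((k + k + |B| * k + |A| * (k + k) : ℤ) : ℝ) + ((k + k + |A| * k + k : ℤ) : ℝ) := by
  have hk : 0 ≤ k := (abs_nonneg _).trans h1
  have n1 : 0 ≤ |B| * k := by positivity
  have n2 : 0 ≤ |A| * k := by positivity
  have m1 : |B * s.1| ≤ |B| * k := by rw [abs_mul]; gcongr
  have m2 : |A * s.1| ≤ |A| * k := by rw [abs_mul]; gcongr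
  have m3 : |A * (s.2.1 - s.1)| ≤ |A| * (k + k) := by
    rw [abs_mul]; gcongr
    exact (abs_sub _ _).trans (by linarith)
  have : |Vz A B s i| ≤ (k + k + |B| * k + |A| * (k + k)) + (k + k + |A| * k + k) := by
    rw [abs_le] at *
    fin_cases i <;> simp only [Vz] <;> constructor <;> simp <;> nlinarith
  have h' : ((|Vz A B s i| : ℤ) : ℝ) ≤ (((k + k + |B| * k + |A| * (k + k)) + (k + k + |A| * k + k) : ℤ) : ℝ) := by
    exact_mod_cast this
  rw [Int.cast_add, Int.cast_abs] at h'
  exact h'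

theorem NN_abs {s : Z3} (h : NN s) : |s.1| ≤ 1 ∧ |s.2.1| ≤ 1 ∧ |s.2.2| ≤ 1 := by
  simp only [NN, abs_le] at *
  omega

/-- A bounded admissible walk gives a pair of points of the tile. -/
theorem Good.walk {A B C : ℤ} {T : Set (Fin 3 → ℝ)} (h : Good A B C T)
    (s : ℕ → Z3) (e : ℕ → ℤ) (he : ∀ n, e n ≤ C - 1 ∧ -(C - 1) ≤ e n)
    (hs : ∀ n, s (n + 1) = phi (s n) + (0, 0, e n - LL A B C (s n)))
    (k : ℤ) (hk : ∀ n, |(s n).1| ≤ k ∧ |(s n).2.1| ≤ k ∧ |(s n).2.2| ≤ k) :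
    ∃ x ∈ T, x - Vr A B (s 0) ∈ T := by
  have hA := h.hA
  have hAB := h.hAB
  have hBC := h.hBC
  obtain ⟨X, hX⟩ := h.chain (fun n => max 0 (- e n)) (fun n => by
    have := he n; constructor <;> simp <;> omega)
  obtain ⟨X', hX'⟩ := h.chain (fun n => max 0 (e n)) (fun n => by
    have := he n; constructor <;> simp <;> omega)
  have := h.pair _ _ X X' hX hX' s (fun n => by
    rw [hs n]
    congr 3
    have : max 0 (e n) - max 0 (- e n) = e n := by omega
    simp only [this]) _ (fun n i => Vr_bound A B (s n) k (hk n).1 (hk n).2.1 (hk n).2.2 i)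
  refine ⟨X 0, (hX 0).1, ?_⟩
  rw [← this]
  simpa using (hX' 0).1

theorem NN_iter {s : Z3} (h : NN s) (n : ℕ) : NN (phi^[n] s) := by
  induction n with
  | zero => exact h
  | succ n ih => rw [Function.iterate_succ_apply']; exact NN_phi ih

theorem Good.nb {A B C : ℤ} {T : Set (Fin 3 → ℝ)} (h : Good A B C T) {s : Z3} (hs : NN s) :
    ∃ x ∈ T, x - Vr A B s ∈ T := by
  refine h.walk (fun n => phi^[n] s) (fun n => LL A B C (phi^[n] s))
    (fun n => LL_bound h.hA h.hAB h.hBC (NN_iter hs n)) (fun n => ?_) 1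
    (fun n => NN_abs (NN_iter hs n))
  rw [Function.iterate_succ_apply']
  simp

def NF : Finset Z3 :=
  ((({-1, 0, 1} : Finset ℤ) ×ˢ ({-1, 0, 1} : Finset ℤ) ×ˢ ({-1, 0, 1} : Finset ℤ)).filter NN).erase 0

theorem NF_card : NF.card = 14 := by decide +kernel

theorem mem_NF {s : Z3} : s ∈ NF ↔ s ≠ 0 ∧ NN s := by
  simp only [NF, Finset.mem_erase, Finset.mem_filter, Finset.mem_product, Finset.mem_insert,
    Finset.mem_singleton, NN]
  constructor
  · rintro ⟨h1, _, h2⟩; exact ⟨h1, h2⟩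
  · rintro ⟨h1, h2⟩
    refine ⟨h1, ?_, h2⟩
    omega

theorem mem_translate {v x : Fin 3 → ℝ} {T : Set (Fin 3 → ℝ)} :
    x ∈ tileTranslate v T ↔ x - v ∈ T := by
  constructor
  · rintro ⟨y, hy, rfl⟩; simpa using hy
  · intro h; exact ⟨_, h, by simp⟩

theorem nbr_iff {A B : ℤ} {T : Set (Fin 3 → ℝ)} (s : Z3) :
    Vz A B s ∈ Neighbors T ↔ s ≠ 0 ∧ ∃ x ∈ T, x - Vr A B s ∈ T := by
  have : Vz A B s ≠ 0 ↔ s ≠ 0 := by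
    rw [not_iff_not]
    constructor
    · intro h; exact Vz_inj A B (h.trans (Vz_zero A B).symm)
    · rintro rfl; exact Vz_zero A B
  simp only [Neighbors, Set.mem_ofPred_eq, this, Set.Nonempty, Set.mem_inter_iff, mem_translate]
  rfl

/-- With exactly 14 neighbors, the neighbors are the expected ones. -/
theorem Good.nbrs {A B C : ℤ} {T : Set (Fin 3 → ℝ)} (h : Good A B C T)
    (h14 : (Neighbors T).ncard = 14) (x : Fin 3 → ℝ) (hx : x ∈ T) (s : Z3)
    (hs : x - Vr A B s ∈ T) : NN s := by
  have hfin : (Neighbors T).Finite := Set.finite_of_ncard_ne_zero (by omega)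
  have hsub : ((NF.image (Vz A B) : Finset _) : Set (Fin 3 → ℤ)) ⊆ Neighbors T := by
    intro α hα
    simp only [Finset.coe_image, Set.mem_image, Finset.mem_coe] at hα
    obtain ⟨s, hs, rfl⟩ := hα
    rw [mem_NF] at hs
    exact (nbr_iff s).2 ⟨hs.1, h.nb hs.2⟩
  have heq := Set.eq_of_subset_of_ncard_le hsub (by
    rw [h14, Set.ncard_coe_finset, Finset.card_image_of_injective _ (Vz_inj A B), NF_card]) hfin
  by_cases h0 : s = 0
  · subst h0; left; simp
  have hm : Vz A B s ∈ Neighbors T := (nbr_iff s).2 ⟨h0, x, hx, hs⟩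
  rw [← heq] at hm
  simp only [Finset.coe_image, Set.mem_image, Finset.mem_coe] at hm
  obtain ⟨t, ht, hts⟩ := hm
  rw [← Vz_inj A B hts]
  exact (mem_NF.1 ht).2

theorem complete : ∀ a ∈ NF, ∀ b ∈ NF, a ≠ b → NN (b - a) →
    ∃ c₁ ∈ NF, (c₁ ≠ a ∧ c₁ ≠ b ∧ NN (c₁ - a) ∧ NN (c₁ - b)) ∧
    ∃ c₂ ∈ NF, (c₂ ≠ a ∧ c₂ ≠ b ∧ NN (c₂ - a) ∧ NN (c₂ - b)) ∧ ¬ NN (c₂ - c₁) ∧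
    ∀ c ∈ NF, (c ≠ a ∧ c ≠ b ∧ NN (c - a) ∧ NN (c - b)) → c = c₁ ∨ c = c₂ := by
  decide +kernel

/-- A clique of four lattice points has a bottom and a top. -/
theorem bot_top (c : Fin 4 → Z3) (hc : Function.Injective c) (hN : ∀ i j, NN (c j - c i)) :
    ∃ b t, c t = c b + (1, 1, 1) ∧ ∀ k, 0 ≤ (c k - c b).1 ∧ (c k - c b).1 ≤ 1 ∧
      0 ≤ (c k - c b).2.1 ∧ (c k - c b).2.1 ≤ 1 ∧ 0 ≤ (c k - c b).2.2 ∧ (c k - c b).2.2 ≤ 1 := by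
  let h : Fin 4 → ℤ := fun i => (c i).1 + (c i).2.1 + (c i).2.2
  have hle : ∀ i j, h j - h i ≤ 3 := by
    intro i j
    have := hN i j
    simp only [NN, Prod.fst_sub, Prod.snd_sub, h] at *
    omega
  have hd : ∀ i j, i ≠ j → h j ≠ h i := by
    intro i j hij he
    apply hij
    apply hc
    have := hN i j
    simp only [NN, Prod.fst_sub, Prod.snd_sub, h] at *
    ext <;> omega
  have hex : ∃ b t, h t = h b + 3 := by
    by_contra hcon
    push Not at hcon
    have hl2 : ∀ i j, h j - h i ≤ 2 := by
      intro i j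
      have := hle i j
      have := hcon i j
      omega
    have := hl2 0 1
    have := hl2 1 0
    have := hl2 0 2
    have := hl2 2 0
    have := hl2 0 3
    have := hl2 3 0
    have := hl2 1 2
    have := hl2 2 1
    have := hl2 1 3
    have := hl2 3 1
    have := hl2 2 3
    have := hl2 3 2
    have := hd 0 1 (by decide)
    have := hd 0 2 (by decide)
    have := hd 0 3 (by decide)
    have := hd 1 2 (by decide)
    have := hd 1 3 (by decide)
    have := hd 2 3 (by decide)
    omega
  obtain ⟨b, t, hbt⟩ := hex
  have htop : c t = c b + (1, 1, 1) := by
    have := hN b t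
    simp only [NN, Prod.fst_sub, Prod.snd_sub, h] at *
    ext <;> simp <;> omega
  refine ⟨b, t, htop, fun k => ?_⟩
  have h1 := hN b k
  have h2 := hN k t
  rw [htop] at h2
  simp only [NN, Prod.fst_sub, Prod.snd_sub, Prod.fst_add, Prod.snd_add] at *
  omega

theorem Good.diff {A B C : ℤ} {T : Set (Fin 3 → ℝ)} (h : Good A B C T)
    (h14 : (Neighbors T).ncard = 14) {y : Fin 3 → ℝ} {s t : Z3}
    (hs : y - Vr A B s ∈ T) (ht : y - Vr A B t ∈ T) : NN (t - s) := by
  refine h.nbrs h14 _ hs _ ?_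
  rw [Vr_sub]
  convert ht using 1
  abel

theorem next_mem {A B C : ℤ} {y : Fin 3 → ℝ} {s : Z3} {d : ℤ} :
    Mm A B C (y - Vr A B s) - dv d =
      Mm A B C y - Vr A B (phi s + (0, 0, d - LL A B C s)) := by
  rw [← Mm_Vr, Mm_sub]
  abel

theorem next_inj {A B C d d' : ℤ} (hd : 0 ≤ d ∧ d < C) (hd' : 0 ≤ d' ∧ d' < C) {s s' : Z3}
    (h : phi s + (0, 0, d - LL A B C s) = phi s' + (0, 0, d' - LL A B C s')) : s = s' := by
  obtain ⟨p, q, r⟩ := s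
  obtain ⟨p', q', r'⟩ := s'
  simp only [phi, LL, Prod.mk_add_mk, Prod.mk.injEq] at h
  obtain ⟨h1, h2, h3⟩ := h
  obtain ⟨k, rfl⟩ : ∃ k, p = p' + k := ⟨p - p', by ring⟩
  obtain rfl : q = q' + k := by linarith
  obtain rfl : r = r' + k := by linarith
  have h4 : d - d' = C * k := by linear_combination h3
  have : k = 0 := by
    have h5 : C * k < C * 1 := by linarith
    have h6 : C * (-1) < C * k := by linarith
    have hC : 0 < C := by linarith
    have := lt_of_mul_lt_mul_left h5 hC.le
    have := lt_of_mul_lt_mul_left h6 hC.le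
    omega
  subst this
  simp

/-- The digits at a fourfold point are forced. -/
theorem Good.digits {A B C : ℤ} {T : Set (Fin 3 → ℝ)} (h : Good A B C T)
    (h14 : (Neighbors T).ncard = 14) (c : Fin 4 → Z3)
    (b t : Fin 4) (htop : c t = c b + (1, 1, 1))
    (hk : ∀ k, 0 ≤ (c k - c b).1 ∧ (c k - c b).1 ≤ 1 ∧
      0 ≤ (c k - c b).2.1 ∧ (c k - c b).2.1 ≤ 1 ∧ 0 ≤ (c k - c b).2.2 ∧ (c k - c b).2.2 ≤ 1)
    (y : Fin 3 → ℝ) (d : Fin 4 → ℤ) (hd : ∀ i, 0 ≤ d i ∧ d i < C)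
    (hnext : ∀ i, Mm A B C (y - Vr A B (c i)) - dv (d i) ∈ T)
    (hc : Function.Injective c) (i : Fin 4) :
    d i = LL A B C (c i) - LL A B C (c b) := by
  simp only [next_mem] at hnext
  have hNN : ∀ i j, NN (phi (c j) + (0, 0, d j - LL A B C (c j)) -
      (phi (c i) + (0, 0, d i - LL A B C (c i)))) := fun i j => h.diff h14 (hnext i) (hnext j)
  have hLt : LL A B C (c t) = LL A B C (c b) + (C - 1) := by
    rw [htop]; simp [LL]; ring
  have hne : c t ≠ c b := by
    rw [htop]; intro h; simpa using congrArg Prod.fst h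
  have e1 : (d t - LL A B C (c t)) - (d b - LL A B C (c b)) = 0 := by
    have h1 := hNN b t
    have h2 := next_inj (A := A) (B := B) (hd t) (hd b) (s := c t) (s' := c b)
    have hb := hd b
    have ht := hd t
    have h2' : ¬ (phi (c t) + (0, 0, d t - LL A B C (c t)) =
      phi (c b) + (0, 0, d b - LL A B C (c b))) := fun hh => hne (h2 hh)
    generalize LL A B C (c t) = Lt at *
    generalize LL A B C (c b) = Lb at *
    simp only [htop, NN, phi, Prod.fst_sub, Prod.snd_sub, Prod.fst_add, Prod.snd_add,
      Prod.mk_add_mk, Prod.mk.injEq] at h1 h2'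
    omega
  have hdb : d b = 0 := by
    have hb := hd b
    have ht := hd t
    omega
  by_cases hib : c i = c b
  · rw [hc hib, hdb]; ring
  by_cases hit : c i = c t
  · rw [hc hit]; omega
  have h1 := hNN b i
  have h2 := hNN t i
  have hki := hk i
  have hib' : ¬ ((c i).1 = (c b).1 ∧ (c i).2.1 = (c b).2.1 ∧ (c i).2.2 = (c b).2.2) := by
    rintro ⟨u, v, w⟩
    exact hib (Prod.ext u (Prod.ext v w))
  have hit' : ¬ ((c i).1 = (c b).1 + 1 ∧ (c i).2.1 = (c b).2.1 + 1 ∧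
      (c i).2.2 = (c b).2.2 + 1) := by
    rintro ⟨u, v, w⟩
    exact hit (by rw [htop]; exact Prod.ext u (Prod.ext v w))
  generalize LL A B C (c t) = Lt at *
  generalize LL A B C (c b) = Lb at *
  generalize LL A B C (c i) = Li at *
  simp only [htop, NN, phi, Prod.fst_sub, Prod.snd_sub, Prod.fst_add, Prod.snd_add] at h1 h2 hki
  omega

theorem Good.uniq_step {A B C : ℤ} {T : Set (Fin 3 → ℝ)} (h : Good A B C T)
    (h14 : (Neighbors T).ncard = 14) (c : Fin 4 → Z3) (hc : Function.Injective c)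
    (y y' : Fin 3 → ℝ) (hy : ∀ i, y - Vr A B (c i) ∈ T) (hy' : ∀ i, y' - Vr A B (c i) ∈ T) :
    ∃ c' : Fin 4 → Z3, Function.Injective c' ∧ (∀ i, Mm A B C y - Vr A B (c' i) ∈ T) ∧
      ∀ i, Mm A B C y' - Vr A B (c' i) ∈ T := by
  obtain ⟨b, t, htop, hk⟩ := bot_top c hc (fun i j => h.diff h14 (hy i) (hy j))
  choose d hd0 hd1 hd using fun i => h.step _ (hy i)
  choose d' hd0' hd1' hd' using fun i => h.step _ (hy' i)
  have e := h.digits h14 c b t htop hk y d (fun i => ⟨hd0 i, hd1 i⟩) hd hc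
  have e' := h.digits h14 c b t htop hk y' d' (fun i => ⟨hd0' i, hd1' i⟩) hd' hc
  have hdd : d = d' := by
    funext i
    rw [e, e']
  subst hdd
  refine ⟨fun i => phi (c i) + (0, 0, d i - LL A B C (c i)), ?_, ?_, ?_⟩
  · intro i j hij
    exact hc (next_inj ⟨hd0 i, hd1 i⟩ ⟨hd0 j, hd1 j⟩ hij)
  · intro i
    rw [← next_mem]; exact hd i
  · intro i
    rw [← next_mem]; exact hd' i

theorem Good.uniq {A B C : ℤ} {T : Set (Fin 3 → ℝ)} (h : Good A B C T)
    (h14 : (Neighbors T).ncard = 14) (c : Fin 4 → Z3) (hc : Function.Injective c)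
    (y y' : Fin 3 → ℝ) (hy : ∀ i, y - Vr A B (c i) ∈ T) (hy' : ∀ i, y' - Vr A B (c i) ∈ T) :
    y = y' := by
  have key : ∀ n : ℕ, ∃ c' : Fin 4 → Z3, Function.Injective c' ∧
      (∀ i, (Mm A B C)^[n] y - Vr A B (c' i) ∈ T) ∧
      ∀ i, (Mm A B C)^[n] y' - Vr A B (c' i) ∈ T := by
    intro n
    induction n with
    | zero => exact ⟨c, hc, hy, hy'⟩
    | succ n ih =>
      obtain ⟨c', h1, h2, h3⟩ := ih
      simp only [Function.iterate_succ_apply']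
      exact h.uniq_step h14 c' h1 _ _ h2 h3
  obtain ⟨R, hR⟩ := h.bdd
  have := orbit_zero A B C h.hA h.hAB h.hBC
    (fun n => (Mm A B C)^[n] y - (Mm A B C)^[n] y')
    (fun n => by simp only [Function.iterate_succ_apply', Mm_sub]) (R + R)
    (fun n i => by
      obtain ⟨c', _, h2, h3⟩ := key n
      have h4 := hR _ (h2 0) i
      have h5 := hR _ (h3 0) i
      simp only [Pi.sub_apply] at *
      rw [abs_le] at *
      constructor <;> linarith [h4.1, h4.2, h5.1, h5.2])
  exact sub_eq_zero.mp this

theorem Good.exist {A B C : ℤ} {T : Set (Fin 3 → ℝ)} (h : Good A B C T)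
    (c : Fin 4 → Z3) (h0 : c 0 = 0) (hN : ∀ i j, NN (c j - c i)) :
    ∃ x, ∀ i, x - Vr A B (c i) ∈ T := by
  have hit : ∀ n (s t : Z3), phi^[n] (s - t) = phi^[n] s - phi^[n] t := by
    intro n s t
    induction n with
    | zero => rfl
    | succ n ih => simp only [Function.iterate_succ_apply', ih, phi_sub]
  have hmin : ∀ n : ℕ, ∃ b : Fin 4, ∀ i, LL A B C (phi^[n] (c b)) ≤ LL A B C (phi^[n] (c i)) :=
    fun n => Finite.exists_min fun i => LL A B C (phi^[n] (c i))
  choose b hb using hmin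
  let d : Fin 4 → ℕ → ℤ := fun i n => LL A B C (phi^[n] (c i)) - LL A B C (phi^[n] (c (b n)))
  have hd : ∀ i n, 0 ≤ d i n ∧ d i n < C := by
    intro i n
    have h1 := hb n i
    have h2 := (LL_bound h.hA h.hAB h.hBC (NN_iter (hN (b n) i) n)).1
    rw [hit, LL_sub] at h2
    simp only [d]
    omega
  choose X hX using fun i => h.chain (d i) (hd i)
  refine ⟨X 0 0, fun i => ?_⟩
  have := h.pair (d 0) (d i) (X 0) (X i) (hX 0) (hX i) (fun n => phi^[n] (c i - c 0))
    (fun n => by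
      rw [Function.iterate_succ_apply']
      have : d i n - d 0 n - LL A B C (phi^[n] (c i - c 0)) = 0 := by
        rw [hit, LL_sub]; simp only [d]; ring
      rw [this]
      exact (add_zero _).symm) _
    (fun n j => by
      have q := NN_abs (NN_iter (hN 0 i) n)
      exact Vr_bound A B _ 1 q.1 q.2.1 q.2.2 j)
  simp only [Function.iterate_zero, id, h0, sub_zero] at this
  rw [← this]
  simpa using (hX i 0).1

theorem NN_zero : NN 0 := by decide

theorem quad_inj {a b c : Z3} (ha : a ≠ 0) (hb : b ≠ 0) (hc : c ≠ 0) (hab : a ≠ b)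
    (hca : c ≠ a) (hcb : c ≠ b) : Function.Injective (![0, a, b, c] : Fin 4 → Z3) := by
  intro i j
  fin_cases i <;> fin_cases j <;> simp <;> intro hh <;> first
    | exact absurd hh ‹_› | exact absurd hh.symm ‹_›

theorem Good.quad {A B C : ℤ} {T : Set (Fin 3 → ℝ)} (h : Good A B C T) {a b c : Z3}
    (ha : NN a) (hb : NN b) (hc : NN c) (hab : NN (b - a)) (hca : NN (c - a)) (hcb : NN (c - b)) :
    ∃ x, ∀ i, x - Vr A B ((![0, a, b, c] : Fin 4 → Z3) i) ∈ T := by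
  apply h.exist _ rfl
  have h1 := NN_neg ha
  have h2 := NN_neg hb
  have h3 := NN_neg hc
  have h4 := NN_neg hab
  have h5 := NN_neg hca
  have h6 := NN_neg hcb
  rw [neg_sub] at h4 h5 h6
  intro i j
  fin_cases i <;> fin_cases j <;> simp [NN_zero] <;> assumption

theorem stmt13 (A B C : ℤ) (T : Set (Fin 3 → ℝ)) (hT : IsABCTile A B C T)
    (h14 : (Neighbors T).ncard = 14) (α β : Fin 3 → ℤ) (hα : α ≠ 0) (hβ : β ≠ 0)
    (hne : α ≠ β) (hint : (T ∩ tileTranslate (toR α) T ∩ tileTranslate (toR β) T).Nonempty) :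
    {x ∈ T ∩ tileTranslate (toR α) T ∩ tileTranslate (toR β) T |
      ∃ γ : Fin 3 → ℤ, γ ∉ ({0, α, β} : Set (Fin 3 → ℤ)) ∧
        x ∈ tileTranslate (toR γ) T}.ncard = 2 := by
  have h := good_of_tile hT
  obtain ⟨a, rfl⟩ := Vz_surj A B α
  obtain ⟨b, rfl⟩ := Vz_surj A B β
  have ha0 : a ≠ 0 := by rintro rfl; exact hα (Vz_zero A B)
  have hb0 : b ≠ 0 := by rintro rfl; exact hβ (Vz_zero A B)
  have hab : a ≠ b := by rintro rfl; exact hne rfl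
  have hin : ∀ s x, x ∈ tileTranslate (toR (Vz A B s)) T ↔ x - Vr A B s ∈ T :=
    fun s x => mem_translate
  have hz : ∀ x, x ∈ T ↔ x - Vr A B 0 ∈ T := fun x => by rw [Vr_zero, sub_zero]
  obtain ⟨x0, ⟨hx1, hx2⟩, hx3⟩ := hint
  rw [hin] at hx2 hx3
  have hNa := h.nbrs h14 _ hx1 _ hx2
  have hNb := h.nbrs h14 _ hx1 _ hx3
  have hNab := h.diff h14 hx2 hx3
  obtain ⟨c₁, hc₁, ⟨h11, h12, h13, h14'⟩, c₂, hc₂, ⟨h21, h22, h23, h24⟩, hcc, hall⟩ :=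
    complete a (mem_NF.2 ⟨ha0, hNa⟩) b (mem_NF.2 ⟨hb0, hNb⟩) hab hNab
  rw [mem_NF] at hc₁ hc₂
  obtain ⟨p₁, hp₁⟩ := h.quad hNa hNb hc₁.2 hNab h13 h14'
  obtain ⟨p₂, hp₂⟩ := h.quad hNa hNb hc₂.2 hNab h23 h24
  have hpne : p₁ ≠ p₂ := by
    rintro rfl
    exact hcc (h.diff h14 (hp₁ 3) (hp₂ 3))
  rw [Set.ncard_eq_two]
  refine ⟨p₁, p₂, hpne, ?_⟩
  have hsol : ∀ p c, c ≠ 0 → c ≠ a → c ≠ b →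
      (∀ i, p - Vr A B ((![0, a, b, c] : Fin 4 → Z3) i) ∈ T) →
      (p ∈ T ∩ tileTranslate (toR (Vz A B a)) T ∩ tileTranslate (toR (Vz A B b)) T ∧
      ∃ γ : Fin 3 → ℤ, γ ∉ ({0, Vz A B a, Vz A B b} : Set (Fin 3 → ℤ)) ∧
        p ∈ tileTranslate (toR γ) T) := by
    intro p c hc0 hca hcb hp
    refine ⟨⟨⟨(hz p).2 (hp 0), (hin _ _).2 (hp 1)⟩, (hin _ _).2 (hp 2)⟩, Vz A B c, ?_,
      (hin _ _).2 (hp 3)⟩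
    rintro (hh | hh | hh)
    · exact hc0 (Vz_inj A B (hh.trans (Vz_zero A B).symm))
    · exact hca (Vz_inj A B hh)
    · exact hcb (Vz_inj A B hh)
  ext x
  constructor
  · rintro ⟨⟨⟨hxT, hxa⟩, hxb⟩, γ, hγ, hxγ⟩
    obtain ⟨c, rfl⟩ := Vz_surj A B γ
    rw [hin] at hxa hxb hxγ
    have hc0 : c ≠ 0 := by rintro rfl; exact hγ (Or.inl (Vz_zero A B))
    have hca : c ≠ a := by rintro rfl; exact hγ (Or.inr (Or.inl rfl))
    have hcb : c ≠ b := by rintro rfl; exact hγ (Or.inr (Or.inr rfl))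
    have hquad : ∀ i, x - Vr A B ((![0, a, b, c] : Fin 4 → Z3) i) ∈ T := by
      intro i
      fin_cases i
      · exact (hz x).1 hxT
      · exact hxa
      · exact hxb
      · exact hxγ
    have hinj := quad_inj ha0 hb0 hc0 hab hca hcb
    rcases hall c (mem_NF.2 ⟨hc0, h.nbrs h14 _ hxT _ hxγ⟩)
      ⟨hca, hcb, h.diff h14 hxa hxγ, h.diff h14 hxb hxγ⟩ with rfl | rfl
    · left; exact h.uniq h14 _ hinj _ _ hquad hp₁
    · right; exact h.uniq h14 _ hinj _ _ hquad hp₂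
  · rintro (rfl | rfl)
    · exact hsol _ _ hc₁.1 h11 h12 hp₁
    · exact hsol _ _ hc₂.1 h21 h22 hp₂
end

section
/- Let T be an ABC-tile having exactly 14 neighbors. Then for every neighbor α of T, the set L_α = ⋃_{β ∈ ℤ³, β ∉ {0, α}} (T ∩ (T + α) ∩ (T + β)) is a Peano continuum: it is compact, connected, and locally connected. -/
open MeasureTheory

namespace ABC

/-- The linear map given by the matrix `M`. -/
def Fm (A B C : ℤ) (x : Fin 3 → ℝ) : Fin 3 → ℝ :=
  ![-(C : ℝ) * x 2, x 0 - (B : ℝ) * x 2, x 1 - (A : ℝ) * x 2]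

/-- Its inverse. -/
noncomputable def Gm (A B C : ℤ) (y : Fin 3 → ℝ) : Fin 3 → ℝ :=
  ![y 1 + (B : ℝ) * (-(y 0) / C), y 2 + (A : ℝ) * (-(y 0) / C), -(y 0) / C]

theorem mulVec_eq (A B C : ℤ) (x : Fin 3 → ℝ) : (Mmat A B C).mulVec x = Fm A B C x := by
  ext i
  fin_cases i <;> simp [Mmat, Fm, Matrix.mulVec, dotProduct, Fin.sum_univ_three] <;> ring

theorem Gm_Fm {A B C : ℤ} (hC : 0 < C) (x : Fin 3 → ℝ) : Gm A B C (Fm A B C x) = x := by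
  have : (C : ℝ) ≠ 0 := by exact_mod_cast hC.ne'
  ext i
  fin_cases i <;> simp [Gm, Fm] <;> field_simp <;> ring

theorem Fm_Gm {A B C : ℤ} (hC : 0 < C) (x : Fin 3 → ℝ) : Fm A B C (Gm A B C x) = x := by
  have : (C : ℝ) ≠ 0 := by exact_mod_cast hC.ne'
  ext i
  fin_cases i <;> simp [Gm, Fm] <;> field_simp

theorem Fm_sub (A B C : ℤ) (x y : Fin 3 → ℝ) :
    Fm A B C (x - y) = Fm A B C x - Fm A B C y := by
  ext i
  fin_cases i <;> simp [Fm] <;> ring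

theorem continuous_Fm (A B C : ℤ) : Continuous (Fm A B C) := by
  unfold Fm
  refine continuous_pi fun i => ?_
  fin_cases i <;> simp <;> fun_prop

theorem continuous_Gm (A B C : ℤ) : Continuous (Gm A B C) := by
  unfold Gm
  refine continuous_pi fun i => ?_
  fin_cases i <;> simp <;> fun_prop

theorem preimage_eq {A B C : ℤ} (hC : 0 < C) (K : Set (Fin 3 → ℝ)) :
    Fm A B C ⁻¹' K = Gm A B C '' K := by
  ext x
  constructor
  · intro h
    exact ⟨_, h, Gm_Fm hC x⟩
  · rintro ⟨y, hy, rfl⟩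
    simpa [Fm_Gm hC] using hy

/-! ### Contraction -/

/-- one window of four consecutive values is bounded by `m` -/
def Win (c : ℕ → ℝ) (n : ℕ) (m : ℝ) : Prop := ∀ i, i < 4 → |c (n + i)| ≤ m

theorem win_rec4 {A B C : ℝ} {c : ℕ → ℝ}
    (hc : ∀ k, c (k + 3) + A * c (k + 2) + B * c (k + 1) + C * c k = 0) (k : ℕ) :
    C * c k = (C - B) * c (k + 1) + (B - A) * c (k + 2) + (A - 1) * c (k + 3) + c (k + 4) := by
  have h1 := hc k
  have h2 := hc (k + 1)
  simp only [add_assoc] at h1 h2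
  norm_num at h1 h2
  linarith

theorem upper_step {A B C : ℝ} {c : ℕ → ℝ} (hA : 1 ≤ A) (hAB : A ≤ B) (hBC : B + 1 ≤ C)
    (hc : ∀ k, c (k + 3) + A * c (k + 2) + B * c (k + 1) + C * c k = 0) (k : ℕ) (m θ : ℝ)
    (hm : 0 ≤ m) (hθ : 0 ≤ θ)
    (h1 : c (k + 1) ≤ (1 - θ) * m) (h2 : c (k + 2) ≤ m) (h3 : c (k + 3) ≤ m)
    (h4 : c (k + 4) ≤ m) : c k ≤ (1 - θ / C) * m := by
  have h := win_rec4 hc k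
  have hC : 0 < C := by linarith
  have e1 : (C - B) * c (k + 1) ≤ (C - B) * ((1 - θ) * m) :=
    mul_le_mul_of_nonneg_left h1 (by linarith)
  have e2 : (B - A) * c (k + 2) ≤ (B - A) * m := mul_le_mul_of_nonneg_left h2 (by linarith)
  have e3 : (A - 1) * c (k + 3) ≤ (A - 1) * m := mul_le_mul_of_nonneg_left h3 (by linarith)
  have e4 : 0 ≤ (C - B - 1) * (θ * m) := mul_nonneg (by linarith) (mul_nonneg hθ hm)
  have e5 : C * c k ≤ C * ((1 - θ / C) * m) := by
    have : C * ((1 - θ / C) * m) = C * m - θ * m := by field_simp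
    rw [this]
    nlinarith
  exact le_of_mul_le_mul_left e5 hC

theorem neg_rec {A B C : ℝ} {c : ℕ → ℝ}
    (hc : ∀ k, c (k + 3) + A * c (k + 2) + B * c (k + 1) + C * c k = 0) :
    ∀ k, (fun j => -c j) (k + 3) + A * (fun j => -c j) (k + 2) + B * (fun j => -c j) (k + 1)
      + C * (fun j => -c j) k = 0 := by
  intro k
  have := hc k
  simp only
  linarith

theorem win_neg {c : ℕ → ℝ} {n : ℕ} {m : ℝ} (h : Win c n m) : Win (fun j => -c j) n m := by
  intro i hi
  simpa using h i hi

theorem win_pred {A B C : ℝ} {c : ℕ → ℝ} (hA : 1 ≤ A) (hAB : A ≤ B) (hBC : B + 1 ≤ C)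
    (hc : ∀ k, c (k + 3) + A * c (k + 2) + B * c (k + 1) + C * c k = 0) (n : ℕ) (m : ℝ)
    (h : Win c (n + 1) m) : Win c n m := by
  have hm : 0 ≤ m := (abs_nonneg _).trans (h 0 (by norm_num))
  have key : ∀ c : ℕ → ℝ, (∀ k, c (k + 3) + A * c (k + 2) + B * c (k + 1) + C * c k = 0) →
      Win c (n + 1) m → c n ≤ m := by
    intro c hc h
    have := upper_step hA hAB hBC hc n m 0 hm le_rfl
      (by simpa using (abs_le.1 (h 0 (by norm_num))).2)
      (by simpa [add_assoc] using (abs_le.1 (h 1 (by norm_num))).2)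
      (by simpa [add_assoc] using (abs_le.1 (h 2 (by norm_num))).2)
      (by simpa [add_assoc] using (abs_le.1 (h 3 (by norm_num))).2)
    simpa using this
  intro i hi
  rcases Nat.eq_zero_or_pos i with rfl | hpos
  · have h1 := key c hc h
    have h2 := key _ (neg_rec hc) (win_neg h)
    exact abs_le.2 ⟨by simp only [add_zero]; linarith, h1⟩
  · have := h (i - 1) (by omega)
    rwa [show n + 1 + (i - 1) = n + i by omega] at this

theorem win_le {A B C : ℝ} {c : ℕ → ℝ} (hA : 1 ≤ A) (hAB : A ≤ B) (hBC : B + 1 ≤ C)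
    (hc : ∀ k, c (k + 3) + A * c (k + 2) + B * c (k + 1) + C * c k = 0) (n j : ℕ) (m : ℝ)
    (h : Win c (n + j) m) : Win c n m := by
  induction j with
  | zero => exact h
  | succ j ih => exact ih (win_pred hA hAB hBC hc _ _ h)

theorem upper_iter {A B C : ℝ} {c : ℕ → ℝ} (hA : 1 ≤ A) (hAB : A ≤ B) (hBC : B + 1 ≤ C)
    (hc : ∀ k, c (k + 3) + A * c (k + 2) + B * c (k + 1) + C * c k = 0) (N : ℕ) (m : ℝ)
    (hm : 0 ≤ m) (hall : ∀ k, k ≤ N + 3 → c k ≤ m) (i : ℕ) :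
    ∀ j, j ≤ N → ∀ k, k + i = j → c j ≤ 0 → c k ≤ (1 - 1 / C ^ i) * m := by
  induction i with
  | zero =>
    intro j _ k hk h0
    have : k = j := by omega
    subst this
    simpa using h0
  | succ i ih =>
    intro j hj k hk h0
    have h1 := ih j hj (k + 1) (by omega) h0
    have hC : 0 < C := by linarith
    have := upper_step hA hAB hBC hc k m (1 / C ^ i) hm (by positivity) h1
      (hall _ (by omega)) (hall _ (by omega)) (hall _ (by omega))
    rwa [div_div, ← pow_succ] at this

theorem win_contract {A B C : ℝ} {c : ℕ → ℝ} (hA : 1 ≤ A) (hAB : A ≤ B) (hBC : B + 1 ≤ C)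
    (hc : ∀ k, c (k + 3) + A * c (k + 2) + B * c (k + 1) + C * c k = 0) (m : ℝ)
    (h : Win c 11 m) : Win c 0 ((1 - 1 / C ^ 11) * m) := by
  have hm : 0 ≤ m := (abs_nonneg _).trans (h 0 (by norm_num))
  have hC : 1 ≤ C := by linarith
  have key : ∀ c : ℕ → ℝ, (∀ k, c (k + 3) + A * c (k + 2) + B * c (k + 1) + C * c k = 0) →
      Win c 11 m → ∀ k, k < 4 → c k ≤ (1 - 1 / C ^ 11) * m := by
    intro c hc h k hk
    have hall : ∀ k, k ≤ 11 + 3 → c k ≤ m := by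
      intro k hk
      by_cases h11 : 11 ≤ k
      · have := (abs_le.1 (h (k - 11) (by omega))).2
        rwa [show 11 + (k - 11) = k by omega] at this
      · have h' : Win c (k + (11 - k)) m := by rwa [show k + (11 - k) = 11 by omega]
        exact (abs_le.1 (win_le hA hAB hBC hc k (11 - k) m h' 0 (by norm_num))).2
    have hex : ∃ j, 8 ≤ j ∧ j ≤ 11 ∧ c j ≤ 0 := by
      by_contra! hcon
      have h8 := hcon 8 (by norm_num) (by norm_num)
      have h9 := hcon 9 (by norm_num) (by norm_num)
      have h10 := hcon 10 (by norm_num) (by norm_num)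
      have h11 := hcon 11 (by norm_num) (by norm_num)
      have := hc 8
      norm_num at this
      have e1 : 0 < A * c 10 := mul_pos (by linarith) h10
      have e2 : 0 < B * c 9 := mul_pos (by linarith) h9
      have e3 : 0 < C * c 8 := mul_pos (by linarith) h8
      linarith
    obtain ⟨j, hj8, hj11, hj0⟩ := hex
    have := upper_iter hA hAB hBC hc 11 m hm hall (j - k) j hj11 k (by omega) hj0
    refine this.trans (mul_le_mul_of_nonneg_right ?_ hm)
    have : 1 / C ^ 11 ≤ 1 / C ^ (j - k) :=
      one_div_le_one_div_of_le (by positivity) (pow_le_pow_right₀ hC (by omega))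
    linarith
  intro i hi
  have h1 := key c hc h i hi
  have h2 := key _ (neg_rec hc) (win_neg h) i hi
  rw [zero_add]
  exact abs_le.2 ⟨by linarith, h1⟩

theorem win_pow {A B C : ℝ} (hA : 1 ≤ A) (hAB : A ≤ B) (hBC : B + 1 ≤ C) (j : ℕ) :
    ∀ (c : ℕ → ℝ) (_ : ∀ k, c (k + 3) + A * c (k + 2) + B * c (k + 1) + C * c k = 0) (m : ℝ)
    (_ : Win c (11 * j) m), Win c 0 ((1 - 1 / C ^ 11) ^ j * m) := by
  induction j with
  | zero => intro c hc m h; simpa using h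
  | succ j ih =>
    intro c hc m h
    have h1 : Win (fun k => c (k + 11)) 0 ((1 - 1 / C ^ 11) ^ j * m) := by
      refine ih (fun k => c (k + 11)) ?_ m ?_
      · intro k
        have := hc (k + 11)
        convert this using 1
      · intro i hi
        have := h i hi
        rwa [show 11 * (j + 1) + i = 11 * j + i + 11 by ring] at this
    have h2 : Win c 11 ((1 - 1 / C ^ 11) ^ j * m) := by
      intro i hi
      have := h1 i hi
      simp only at this
      rwa [show 0 + i + 11 = 11 + i by ring] at this
    have := win_contract hA hAB hBC hc _ h2
    rwa [← mul_assoc, ← pow_succ'] at this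

/-- The small neighbourhoods. -/
def Vn (A B C : ℤ) (R : ℝ) (n : ℕ) : Set (Fin 3 → ℝ) :=
  {x | ∀ k, k < 4 → |((Fm A B C)^[n + k] x) 2| ≤ R}

theorem mem_Vn_succ (A B C : ℤ) (R : ℝ) (n : ℕ) (x : Fin 3 → ℝ) :
    x ∈ Vn A B C R (n + 1) ↔ Fm A B C x ∈ Vn A B C R n := by
  unfold Vn
  simp only [Set.mem_ofPred_eq]
  refine forall_congr' fun k => ?_
  rw [show n + 1 + k = (n + k) + 1 by ring, Function.iterate_succ_apply]

theorem orbit_rec (A B C : ℤ) (x : Fin 3 → ℝ) (k : ℕ) :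
    ((Fm A B C)^[k + 3] x) 2 + (A : ℝ) * ((Fm A B C)^[k + 2] x) 2
      + (B : ℝ) * ((Fm A B C)^[k + 1] x) 2 + (C : ℝ) * ((Fm A B C)^[k] x) 2 = 0 := by
  rw [show k + 3 = (k + 2) + 1 by ring, Function.iterate_succ_apply' _ (k + 2),
    show k + 2 = (k + 1) + 1 by ring, Function.iterate_succ_apply' _ (k + 1),
    Function.iterate_succ_apply' _ k]
  generalize (Fm A B C)^[k] x = y
  simp [Fm]

theorem Vn_small {A B C : ℤ} (hA : 1 ≤ A) (hAB : A ≤ B) (hBC : B < C) (R : ℝ) (ε : ℝ)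
    (hε : 0 < ε) : ∃ N, ∀ j, N ≤ j → ∀ x ∈ Vn A B C R (11 * j), ‖x‖ < ε := by
  have hA' : (1 : ℝ) ≤ A := by exact_mod_cast hA
  have hAB' : (A : ℝ) ≤ B := by exact_mod_cast hAB
  have hBC' : (B : ℝ) + 1 ≤ C := by exact_mod_cast hBC
  have hC : (2 : ℝ) ≤ C := by linarith
  set ρ : ℝ := 1 - 1 / (C : ℝ) ^ 11 with hρ
  have hp1 : (1 : ℝ) ≤ (C : ℝ) ^ 11 := one_le_pow₀ (by linarith)
  have hρ0 : 0 ≤ ρ := by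
    have : 1 / (C : ℝ) ^ 11 ≤ 1 := by
      rw [div_le_one (by positivity)]; exact hp1
    linarith
  have hρ1 : ρ < 1 := by
    have : 0 < 1 / (C : ℝ) ^ 11 := by positivity
    linarith
  have ht : Filter.Tendsto (fun j : ℕ => (1 + (A : ℝ) + B) * (ρ ^ j * R)) Filter.atTop
      (nhds ((1 + (A : ℝ) + B) * (0 * R))) :=
    ((tendsto_pow_atTop_nhds_zero_of_lt_one hρ0 hρ1).mul_const R).const_mul _
  simp only [zero_mul, mul_zero] at ht
  obtain ⟨N, hN⟩ := Filter.eventually_atTop.1 (ht.eventually_lt_const hε)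
  refine ⟨N, fun j hj x hx => ?_⟩
  have hw : Win (fun k => ((Fm A B C)^[k] x) 2) 0 (ρ ^ j * R) :=
    win_pow hA' hAB' hBC' j _ (orbit_rec A B C x) R hx
  have h0 := hw 0 (by norm_num)
  have h1 := hw 1 (by norm_num)
  have h2 := hw 2 (by norm_num)
  have hj := hN j hj
  set m := ρ ^ j * R
  have hm : 0 ≤ m := (abs_nonneg _).trans h0
  simp [Fm] at h0 h1 h2
  rw [abs_le] at h0 h1 h2
  refine (pi_norm_lt_iff hε).2 fun i => ?_
  rw [Real.norm_eq_abs]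
  refine lt_of_le_of_lt ?_ hj
  have p1 : (A : ℝ) * x 2 ≤ A * m := mul_le_mul_of_nonneg_left h0.2 (by linarith)
  have p2 : (A : ℝ) * (-m) ≤ A * x 2 := mul_le_mul_of_nonneg_left h0.1 (by linarith)
  have p3 : (B : ℝ) * x 2 ≤ B * m := mul_le_mul_of_nonneg_left h0.2 (by linarith)
  have p4 : (B : ℝ) * (-m) ≤ B * x 2 := mul_le_mul_of_nonneg_left h0.1 (by linarith)
  have p5 : (A : ℝ) * (x 1 - A * x 2) ≤ A * m := mul_le_mul_of_nonneg_left h1.2 (by linarith)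
  have p6 : (A : ℝ) * (-m) ≤ A * (x 1 - A * x 2) := mul_le_mul_of_nonneg_left h1.1 (by linarith)
  have p7 : 0 ≤ (A : ℝ) * m := mul_nonneg (by linarith) hm
  have p8 : 0 ≤ (B : ℝ) * m := mul_nonneg (by linarith) hm
  fin_cases i <;> simp only [Fin.zero_eta, Fin.mk_one, Fin.reduceFinMk] <;> rw [abs_le] <;>
    constructor <;> linarith

end ABC

namespace ABC

open Relation

abbrev W := ℤ × ℤ × ℤ
abbrev E3 := Fin 3 → ℝ

/-! ### Small pieces and local connectedness -/

theorem locConn_of_cover {X : Type*} [MetricSpace X] (L : Set X)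
    (h : ∀ ε > 0, ∃ 𝒦 : Set (Set X), 𝒦.Finite ∧ ⋃₀ 𝒦 = L ∧
      ∀ K ∈ 𝒦, IsCompact K ∧ IsPreconnected K ∧ ∀ x ∈ K, ∀ y ∈ K, dist x y < ε) :
    LocallyConnectedSpace L := by
  refine locallyConnectedSpace_of_connected_bases (fun x (s : Set L) => s)
    (fun x s => s ∈ nhds x ∧ IsPreconnected s) ?_ (fun x s hs => hs.2)
  intro x
  refine Filter.hasBasis_iff.2 fun t => ⟨fun ht => ?_, fun ⟨s, hs, hst⟩ =>
    Filter.mem_of_superset hs.1 hst⟩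
  obtain ⟨ε, hε, hball⟩ := Metric.mem_nhds_iff.1 ht
  obtain ⟨𝒦, hfin, hU, hK⟩ := h ε hε
  let V : Set X := ⋃₀ {K ∈ 𝒦 | (x : X) ∈ K}
  have hVL : V ⊆ L := by
    rw [← hU]
    exact Set.sUnion_subset_sUnion fun K hK => hK.1
  have hV : IsPreconnected V :=
    isPreconnected_sUnion (x : X) _ (fun K hK => hK.2) (fun K hk => (hK K hk.1).2.1)
  let Z : Set X := ⋃₀ {K ∈ 𝒦 | (x : X) ∉ K}
  have hZ : IsClosed Z := by
    rw [show Z = ⋃ K ∈ {K ∈ 𝒦 | (x : X) ∉ K}, K from Set.sUnion_eq_biUnion]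
    refine Set.Finite.isClosed_biUnion (hfin.subset fun K hK => hK.1) ?_
    exact fun K hk => (hK K hk.1).1.isClosed
  have hxZ : (x : X) ∈ Zᶜ := by
    rintro ⟨K, hk, hx⟩
    exact hk.2 hx
  refine ⟨Subtype.val ⁻¹' V, ⟨?_, ?_⟩, ?_⟩
  · have : (Subtype.val ⁻¹' Zᶜ : Set L) ∈ nhds x :=
      continuous_subtype_val.continuousAt.preimage_mem_nhds (hZ.isOpen_compl.mem_nhds hxZ)
    refine Filter.mem_of_superset this ?_
    intro y hy
    have hyL : (y : X) ∈ ⋃₀ 𝒦 := by rw [hU]; exact y.2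
    obtain ⟨K, hk, hyK⟩ := hyL
    by_cases hxK : (x : X) ∈ K
    · exact ⟨K, ⟨hk, hxK⟩, hyK⟩
    · exact absurd ⟨K, ⟨hk, hxK⟩, hyK⟩ hy
  · refine (Topology.IsInducing.subtypeVal.isPreconnected_image).1 ?_
    rwa [Subtype.image_preimage_coe, Set.inter_eq_right.2 hVL]
  · intro y hy
    obtain ⟨K, hk, hyK⟩ := hy
    exact hball ((hK K hk.1).2.2 _ hyK _ hk.2)

/-! ### Chains -/

/-- Any two points of `K` are joined by a chain in `K` with steps in `V`. -/
def Chn (V K : Set E3) : Prop :=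
  ∀ x ∈ K, ∀ y ∈ K, ReflTransGen (fun a b => a ∈ K ∧ b ∈ K ∧ b - a ∈ V) x y

theorem preconn_of_chn {K : Set E3} (hK : IsCompact K)
    (h : ∀ ε > 0, ∃ V : Set E3, (∀ v ∈ V, ‖v‖ < ε) ∧ Chn V K) : IsPreconnected K := by
  rw [isPreconnected_closed_iff]
  intro s t hs ht hst ⟨x, hxK, hxs⟩ ⟨y, hyK, hyt⟩
  by_contra hcon
  have hdisj : Disjoint (K ∩ s) (K ∩ t) := by
    rw [Set.disjoint_left]
    rintro z ⟨hz, hzs⟩ ⟨_, hzt⟩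
    exact hcon ⟨z, hz, hzs, hzt⟩
  obtain ⟨ε, hε, hd⟩ := hdisj.exists_thickenings (hK.inter_right hs)
    (hK.inter_right ht).isClosed
  obtain ⟨V, hV, hch⟩ := h ε hε
  have : ∀ z, ReflTransGen (fun a b => a ∈ K ∧ b ∈ K ∧ b - a ∈ V) x z → z ∈ K ∩ s := by
    intro z hz
    induction hz with
    | refl => exact ⟨hxK, hxs⟩
    | @tail a b _ hab ih =>
      refine ⟨hab.2.1, ?_⟩
      rcases hst hab.2.1 with hb | hb
      · exact hb
      · exfalso
        have hd' := Set.disjoint_left.1 hd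
        refine @hd' b ?_ ?_
        · refine Metric.mem_thickening_iff.2 ⟨a, ih, ?_⟩
          rw [dist_eq_norm]
          exact hV _ hab.2.2
        · exact Metric.self_subset_thickening hε _ ⟨hab.2.1, hb⟩
  exact hcon ⟨y, hyK, (this y (hch x hxK y hyK)).2, hyt⟩

theorem chn_iUnion {ι : Type*} {V : Set E3} (S : Set ι) (I : ι → Set E3)
    (h : ∀ i ∈ S, Chn V (I i))
    (hl : ∀ i ∈ S, ∀ j ∈ S,
      ReflTransGen (fun p q => p ∈ S ∧ q ∈ S ∧ (I p ∩ I q).Nonempty) i j) :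
    Chn V (⋃ i ∈ S, I i) := by
  have hmono : ∀ i ∈ S, ∀ x ∈ I i, ∀ y ∈ I i, ReflTransGen
      (fun a b => a ∈ (⋃ i ∈ S, I i) ∧ b ∈ (⋃ i ∈ S, I i) ∧ b - a ∈ V) x y := by
    intro i hi x hx y hy
    refine ReflTransGen.mono ?_ _ _ (h i hi x hx y hy)
    intro a b hab
    exact ⟨Set.mem_biUnion hi hab.1, Set.mem_biUnion hi hab.2.1, hab.2.2⟩
  intro x hx y hy
  simp only [Set.mem_iUnion] at hx hy
  obtain ⟨i, hi, hx⟩ := hx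
  obtain ⟨j, hj, hy⟩ := hy
  have key : ∀ j, ReflTransGen (fun p q => p ∈ S ∧ q ∈ S ∧ (I p ∩ I q).Nonempty) i j →
      j ∈ S → ∀ y ∈ I j, ReflTransGen
      (fun a b => a ∈ (⋃ i ∈ S, I i) ∧ b ∈ (⋃ i ∈ S, I i) ∧ b - a ∈ V) x y := by
    intro j hij
    induction hij with
    | refl => intro _ y hy; exact hmono i hi x hx y hy
    | @tail p q _ hpq ih =>
      intro hq y hy
      obtain ⟨z, hzp, hzq⟩ := hpq.2.2
      exact (ih hpq.1 z hzp).trans (hmono q hq z hzq y hy)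
  exact key j (hl i hi j hj) hj y hy

theorem chn_preimage {A B C : ℤ} (hC : 0 < C) {V K : Set E3} (h : Chn V K) :
    Chn (Fm A B C ⁻¹' V) (Fm A B C ⁻¹' K) := by
  intro x hx y hy
  have := h _ hx _ hy
  have := ReflTransGen.lift (Gm A B C) (p := fun a b => a ∈ Fm A B C ⁻¹' K ∧
    b ∈ Fm A B C ⁻¹' K ∧ b - a ∈ Fm A B C ⁻¹' V) ?_ _ _ this
  · simpa only [Function.onFun, Gm_Fm hC] using this
  · rintro a b ⟨ha, hb, hab⟩
    simp only [Function.onFun, Set.mem_preimage, Fm_sub, Fm_Gm hC]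
    exact ⟨ha, hb, hab⟩

/-! ### Tiles in adapted coordinates -/

/-- Lattice point with adapted coordinates `u`. -/
def Ph (A B : ℤ) (u : W) : Fin 3 → ℤ := ![u.2.2 + A * u.2.1 + B * u.1, u.2.1 + A * u.1, u.1]

/-- The translated tile. -/
def Tl (A B : ℤ) (T : Set E3) (u : W) : Set E3 := {x | x - toR (Ph A B u) ∈ T}

/-- Transition of lattice points under the map `M`. -/
def Stp (A B C : ℤ) (u v : W) : Prop :=
  v.1 = u.2.1 ∧ v.2.1 = u.2.2 ∧ 0 ≤ v.2.2 + A * u.2.2 + B * u.2.1 + C * u.1 ∧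
    v.2.2 + A * u.2.2 + B * u.2.1 + C * u.1 < C

theorem Fm_toR (A B C : ℤ) (u v : W) (h1 : v.1 = u.2.1) (h2 : v.2.1 = u.2.2) :
    Fm A B C (toR (Ph A B u)) =
      toR (Ph A B v) - ![((v.2.2 + A * u.2.2 + B * u.2.1 + C * u.1 : ℤ) : ℝ), 0, 0] := by
  ext i
  fin_cases i <;> simp [Fm, toR, Ph, h1, h2]

theorem mem_Tl_iff {A B C : ℤ} {T : Set E3} (hT : IsABCTile A B C T) (u : W) (x : E3) :
    x ∈ Tl A B T u ↔ ∃ v, Stp A B C u v ∧ Fm A B C x ∈ Tl A B T v := by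
  obtain ⟨hA, hAB, hBC, -, -, -, hset⟩ := hT
  have hC : 0 < C := by omega
  have hset' : ∀ y, y ∈ Fm A B C '' T ↔ ∃ i : ℤ, 0 ≤ i ∧ i < C ∧ y - ![(i : ℝ), 0, 0] ∈ T := by
    intro y
    have : (Fm A B C '' T) = (Mmat A B C).mulVec '' T := by
      congr 1; funext x; exact (mulVec_eq A B C x).symm
    rw [this, hset]
    simp only [Set.mem_iUnion, Ddig, tileTranslate, Set.mem_ofPred_eq, Set.mem_image]
    constructor
    · rintro ⟨d, ⟨i, h0, h1, rfl⟩, z, hz, rfl⟩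
      exact ⟨i, h0, h1, by rwa [add_sub_cancel_right]⟩
    · rintro ⟨i, h0, h1, hz⟩
      exact ⟨_, ⟨i, h0, h1, rfl⟩, _, hz, sub_add_cancel _ _⟩
  have hinj : Function.Injective (Fm A B C) := Function.LeftInverse.injective (Gm_Fm hC)
  have e : x ∈ Tl A B T u ↔ Fm A B C (x - toR (Ph A B u)) ∈ Fm A B C '' T := by
    rw [hinj.mem_set_image]; rfl
  rw [e, hset', Fm_sub]
  constructor
  · rintro ⟨i, h0, h1, hi⟩
    refine ⟨(u.2.1, u.2.2, i - (A * u.2.2 + B * u.2.1 + C * u.1)), ⟨rfl, rfl, ?_, ?_⟩, ?_⟩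
    · simp only; linarith
    · simp only; linarith
    · rw [Fm_toR A B C u (u.2.1, u.2.2, i - (A * u.2.2 + B * u.2.1 + C * u.1)) rfl rfl] at hi
      unfold Tl
      simp only [Set.mem_ofPred_eq]
      convert hi using 1
      rw [show (i - (A * u.2.2 + B * u.2.1 + C * u.1)) + A * u.2.2 + B * u.2.1 + C * u.1 = i by ring]
      abel
  · rintro ⟨v, ⟨h1, h2, h3, h4⟩, hv⟩
    refine ⟨_, h3, h4, ?_⟩
    rw [Fm_toR A B C u v h1 h2]
    have hv' : Fm A B C x - toR (Ph A B v) ∈ T := hv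
    convert hv' using 1
    abel

theorem isCompact_Tl {A B C : ℤ} {T : Set E3} (hT : IsABCTile A B C T) (u : W) :
    IsCompact (Tl A B T u) := by
  have : Tl A B T u = (fun x => x + toR (Ph A B u)) '' T := by
    ext x
    simp only [Tl, Set.mem_ofPred_eq, Set.mem_image]
    exact ⟨fun h => ⟨_, h, by simp⟩, by rintro ⟨y, hy, rfl⟩; simpa using hy⟩
  rw [this]
  exact hT.2.2.2.2.1.image (by fun_prop)

/-! ### Combinatorics -/

/-- The difference of the two windows alternates. -/
def walt (u v : W) : Prop :=
  -1 ≤ v.1 - u.1 ∧ v.1 - u.1 ≤ 1 ∧ -1 ≤ v.2.1 - u.2.1 ∧ v.2.1 - u.2.1 ≤ 1 ∧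
  -1 ≤ v.2.2 - u.2.2 ∧ v.2.2 - u.2.2 ≤ 1 ∧
  -1 ≤ (v.1 - u.1) + (v.2.1 - u.2.1) ∧ (v.1 - u.1) + (v.2.1 - u.2.1) ≤ 1 ∧
  -1 ≤ (v.2.1 - u.2.1) + (v.2.2 - u.2.2) ∧ (v.2.1 - u.2.1) + (v.2.2 - u.2.2) ≤ 1 ∧
  -1 ≤ (v.1 - u.1) + (v.2.1 - u.2.1) + (v.2.2 - u.2.2) ∧
  (v.1 - u.1) + (v.2.1 - u.2.1) + (v.2.2 - u.2.2) ≤ 1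

instance : DecidableRel walt := fun u v => by unfold walt; infer_instance

theorem walt_symm {u v : W} (h : walt u v) : walt v u := by
  unfold walt at *
  omega

theorem walt_refl (u : W) : walt u u := by
  unfold walt
  omega

theorem walt_cases (x y z : ℤ) (h : walt (0, 0, 0) (x, y, z)) :
    (x, y, z) ∈ ([(0,0,0), (1,0,0), (0,1,0), (0,0,1), (1,-1,0), (0,1,-1), (1,0,-1), (1,-1,1),
      (-1,0,0), (0,-1,0), (0,0,-1), (-1,1,0), (0,-1,1), (-1,0,1), (-1,1,-1)] : List W) := by
  have hx : x ∈ Finset.Icc (-1 : ℤ) 1 := by simp only [walt] at h; simp; omega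
  have hy : y ∈ Finset.Icc (-1 : ℤ) 1 := by simp only [walt] at h; simp; omega
  have hz : z ∈ Finset.Icc (-1 : ℤ) 1 := by simp only [walt] at h; simp; omega
  revert x y z
  have : ∀ x ∈ Finset.Icc (-1 : ℤ) 1, ∀ y ∈ Finset.Icc (-1 : ℤ) 1, ∀ z ∈ Finset.Icc (-1 : ℤ) 1,
    walt (0, 0, 0) (x, y, z) → 
    (x, y, z) ∈ ([(0,0,0), (1,0,0), (0,1,0), (0,0,1), (1,-1,0), (0,1,-1), (1,0,-1), (1,-1,1),
      (-1,0,0), (0,-1,0), (0,0,-1), (-1,1,0), (0,-1,1), (-1,0,1), (-1,1,-1)] : List W) := by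
    decide +kernel
  intro x y z h hx hy hz
  exact this x hx y hy z hz h

/-- The function controlling the digits of the periodic extension. -/
def ff (A B C : ℤ) (u : W) : ℤ := (A - 1) * u.2.2 + (B - 1) * u.2.1 + (C - 1) * u.1

theorem ff_bound {A B C : ℤ} (hA : 1 ≤ A) (hAB : A ≤ B) (hBC : B < C) {u v : W}
    (h : walt u v) : ff A B C v - ff A B C u ≤ C - 1 := by
  have e : ff A B C v - ff A B C u = (A - 1) * (v.2.2 - u.2.2) + (B - 1) * (v.2.1 - u.2.1)
      + (C - 1) * (v.1 - u.1) := by unfold ff; ring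
  have h' : walt (0, 0, 0) (v.1 - u.1, v.2.1 - u.2.1, v.2.2 - u.2.2) := by
    simpa [walt] using h
  rw [e]
  have := walt_cases _ _ _ h'
  simp only [List.mem_cons, Prod.mk.injEq, List.not_mem_nil, or_false] at this
  rcases this with h | h | h | h | h | h | h | h | h | h | h | h | h | h | h <;>
    rw [h.1, h.2.1, h.2.2] <;> omega

theorem extend_family {A B C : ℤ} (hA : 1 ≤ A) (hAB : A ≤ B) (hBC : B < C) {r : ℕ}
    (U : Fin (r + 1) → W) (hU : ∀ i j, walt (U i) (U j)) :
    ∃ U' : Fin (r + 1) → W, (∀ i j, walt (U' i) (U' j)) ∧ ∀ i, Stp A B C (U i) (U' i) := by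
  obtain ⟨i0, hi0⟩ := Finite.exists_min (fun i => ff A B C (U i))
  refine ⟨fun i => ((U i).2.1, (U i).2.2,
    -ff A B C (U i0) - ((U i).1 + (U i).2.1 + (U i).2.2)), ?_, ?_⟩
  · intro i j
    have := hU i j
    simp only [walt] at *
    omega
  · intro i
    have h1 := ff_bound hA hAB hBC (hU i0 i)
    have h2 := hi0 i
    have e : -ff A B C (U i0) - ((U i).1 + (U i).2.1 + (U i).2.2) + A * (U i).2.2
      + B * (U i).2.1 + C * (U i).1 = ff A B C (U i) - ff A B C (U i0) := by
      unfold ff; ring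
    refine ⟨rfl, rfl, ?_, ?_⟩
    · simp only
      rw [e]; linarith
    · simp only
      rw [e]; linarith

end ABC

namespace ABC

open Relation

/-! ### Nonempty intersections -/

theorem compact_sub_Vn (A B C : ℤ) {K : Set E3} (hK : IsCompact K) :
    ∃ R, ∀ x ∈ K, x ∈ Vn A B C R 0 := by
  have hc : Continuous fun x : E3 => ∑ k ∈ Finset.range 4, |((Fm A B C)^[0 + k] x) 2| := by
    refine continuous_finsetSum _ fun k _ => ?_
    exact ((continuous_apply 2).comp ((continuous_Fm A B C).iterate _)).abs
  obtain ⟨R, hR⟩ := hK.bddAbove_image hc.continuousOn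
  refine ⟨R, fun x hx k hk => ?_⟩
  refine le_trans ?_ (hR ⟨x, hx, rfl⟩)
  exact Finset.single_le_sum (f := fun k => |((Fm A B C)^[0 + k] x) 2|)
    (fun _ _ => abs_nonneg _) (Finset.mem_range.2 hk)

theorem toR_sub (A B : ℤ) (u v : W) :
    toR (Ph A B v) - toR (Ph A B u) =
      toR (Ph A B (v.1 - u.1, v.2.1 - u.2.1, v.2.2 - u.2.2)) := by
  ext i
  fin_cases i <;> simp [toR, Ph] <;> ring

theorem exists_R {A B C : ℤ} {T : Set E3} (hT : IsABCTile A B C T) :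
    ∃ R, (∀ u, ∀ x ∈ Tl A B T u, ∀ y ∈ Tl A B T u, y - x ∈ Vn A B C R 0) ∧
      ∀ u v, walt u v → toR (Ph A B v) - toR (Ph A B u) ∈ Vn A B C R 0 := by
  have hTc : IsCompact T := hT.2.2.2.2.1
  let S : Set W := {w | walt (0, 0, 0) w}
  have hS : S.Finite := by
    refine (List.finite_toSet _).subset fun w hw => walt_cases w.1 w.2.1 w.2.2 hw
  have hK : IsCompact ((fun p : E3 × E3 => p.2 - p.1) '' (T ×ˢ T) ∪
      (fun w => toR (Ph A B w)) '' S) :=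
    ((hTc.prod hTc).image (by fun_prop)).union (hS.image _).isCompact
  obtain ⟨R, hR⟩ := compact_sub_Vn A B C hK
  refine ⟨R, fun u x hx y hy => ?_, fun u v huv => ?_⟩
  · refine hR _ (Or.inl ⟨(x - toR (Ph A B u), y - toR (Ph A B u)), ⟨hx, hy⟩, ?_⟩)
    simp
  · refine hR _ (Or.inr ⟨(v.1 - u.1, v.2.1 - u.2.1, v.2.2 - u.2.2), ?_, ?_⟩)
    · simpa [S, walt] using huv
    · exact (toR_sub A B u v).symm

theorem approx_family {A B C : ℤ} {T : Set E3} (hT : IsABCTile A B C T) {R : ℝ}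
    (hR : ∀ u v, walt u v → toR (Ph A B v) - toR (Ph A B u) ∈ Vn A B C R 0) {r : ℕ} (n : ℕ) :
    ∀ U : Fin (r + 1) → W, (∀ i j, walt (U i) (U j)) →
    ∃ x : Fin (r + 1) → E3, (∀ i, x i ∈ Tl A B T (U i)) ∧ ∀ i j, x j - x i ∈ Vn A B C R n := by
  have hC : 0 < C := by have := hT.1; have := hT.2.1; have := hT.2.2.1; omega
  induction n with
  | zero =>
    intro U hU
    obtain ⟨y, hy⟩ := hT.2.2.2.1
    refine ⟨fun i => y + toR (Ph A B (U i)), fun i => ?_, fun i j => ?_⟩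
    · simpa [Tl] using hy
    · simpa using hR _ _ (hU i j)
  | succ n ih =>
    intro U hU
    obtain ⟨U', hU', hst⟩ := extend_family hT.1 hT.2.1 hT.2.2.1 U hU
    obtain ⟨x, hx, hxx⟩ := ih U' hU'
    refine ⟨fun i => Gm A B C (x i), fun i => ?_, fun i j => ?_⟩
    · exact (mem_Tl_iff hT _ _).2 ⟨U' i, hst i, by rw [Fm_Gm hC]; exact hx i⟩
    · rw [mem_Vn_succ, Fm_sub, Fm_Gm hC, Fm_Gm hC]
      exact hxx i j

theorem nonempty_family {A B C : ℤ} {T : Set E3} (hT : IsABCTile A B C T) {r : ℕ}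
    (U : Fin (r + 1) → W) (hU : ∀ i j, walt (U i) (U j)) : ∃ x, ∀ i, x ∈ Tl A B T (U i) := by
  obtain ⟨R, -, hR⟩ := exists_R hT
  choose X hX hXX using fun n : ℕ => approx_family hT hR (11 * n) U hU
  obtain ⟨a, -, φ, hφ, ha⟩ := (isCompact_Tl hT (U 0)).tendsto_subseq (fun n => hX n 0)
  refine ⟨a, fun i => ?_⟩
  have hd : Filter.Tendsto (fun n => X (φ n) i - X (φ n) 0) Filter.atTop (nhds 0) := by
    rw [Metric.tendsto_atTop]
    intro ε hε
    obtain ⟨N, hN⟩ := Vn_small hT.1 hT.2.1 hT.2.2.1 R ε hε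
    refine ⟨N, fun n hn => ?_⟩
    rw [dist_zero_right]
    exact hN (φ n) (hn.trans (hφ.id_le n)) _ (hXX (φ n) 0 i)
  have hi : Filter.Tendsto (fun n => X (φ n) i) Filter.atTop (nhds a) := by
    have := hd.add ha
    simpa using this
  exact (isCompact_Tl hT (U i)).isClosed.mem_of_tendsto hi
    (Filter.Eventually.of_forall fun n => hX (φ n) i)

theorem quad_nonempty {A B C : ℤ} {T : Set E3} (hT : IsABCTile A B C T) {p q r s : W}
    (h1 : walt p q) (h2 : walt p r) (h3 : walt p s) (h4 : walt q r) (h5 : walt q s)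
    (h6 : walt r s) :
    ∃ x, x ∈ Tl A B T p ∧ x ∈ Tl A B T q ∧ x ∈ Tl A B T r ∧ x ∈ Tl A B T s := by
  obtain ⟨x, hx⟩ := nonempty_family hT (r := 3) ![p, q, r, s] (by
    intro i j
    fin_cases i <;> fin_cases j <;> first
      | exact walt_refl _
      | assumption
      | (apply walt_symm; assumption))
  exact ⟨x, hx 0, hx 1, hx 2, hx 3⟩

/-! ### Decomposition of triple intersections -/

/-- Distinct windows whose difference alternates. -/
def adj (u v : W) : Prop := walt u v ∧ u ≠ v

theorem adj_symm {u v : W} (h : adj u v) : adj v u := ⟨walt_symm h.1, h.2.symm⟩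

def Gd (t : W × W × W) : Prop := adj t.1 t.2.1 ∧ adj t.1 t.2.2 ∧ adj t.2.1 t.2.2

def Tr (A B : ℤ) (T : Set E3) (t : W × W × W) : Set E3 :=
  Tl A B T t.1 ∩ Tl A B T t.2.1 ∩ Tl A B T t.2.2

def Lt (u v : W) : Prop :=
  u.2.2 < v.2.2 ∨ (u.2.2 = v.2.2 ∧ u.2.1 < v.2.1) ∨
    (u.2.2 = v.2.2 ∧ u.2.1 = v.2.1 ∧ u.1 < v.1)

theorem Lt_total {u v : W} (h : u ≠ v) : Lt u v ∨ Lt v u := by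
  obtain ⟨a, b, c⟩ := u
  obtain ⟨a', b', c'⟩ := v
  simp only [Lt, ne_eq, Prod.mk.injEq] at *
  omega

/-- successor window -/
def nx (u : W) (a : ℤ) : W := (u.2.1, u.2.2, a)

theorem last_case {A B C : ℤ} {u v : W} (h : walt u v) (h1 : u.2.2 = v.2.2)
    (h2 : u.2.1 = v.2.1) (h3 : u.1 < v.1) {a b : ℤ} (hu : Stp A B C u (nx u a))
    (hv : Stp A B C v (nx v b)) : b + 1 ≤ a := by
  have e : v.1 = u.1 + 1 := by unfold walt at h; omega
  obtain ⟨-, -, h4, -⟩ := hu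
  obtain ⟨-, -, -, h5⟩ := hv
  rw [e, ← h1, ← h2, mul_add] at h5
  simp only [nx] at h4 h5
  omega

theorem pairA {A B C : ℤ} {u v : W} (h : walt u v) (hl : Lt u v) {a b : ℤ}
    (hu : Stp A B C u (nx u a)) (hv : Stp A B C v (nx v b)) (hw : walt (nx u a) (nx v b)) :
    b ≤ a ∧ a ≤ b + 1 := by
  rcases hl with h1 | ⟨h1, h2⟩ | ⟨h1, h2, h3⟩
  · simp only [walt, nx] at *
    omega
  · simp only [walt, nx] at *
    omega
  · have := last_case h h1 h2 h3 hu hv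
    simp only [walt, nx] at *
    omega

theorem pairB {A B C : ℤ} {u v : W} (h : walt u v) (hl : Lt u v) {a b : ℤ}
    (hu : Stp A B C u (nx u a)) (hv : Stp A B C v (nx v b)) (h1 : b ≤ a) (h2 : a ≤ b + 1) :
    adj (nx u a) (nx v b) := by
  have hne : nx u a ≠ nx v b := by
    intro he
    simp only [nx, Prod.mk.injEq] at he
    rcases hl with h1 | ⟨h1, h2⟩ | ⟨h1, h2, h3⟩
    · omega
    · omega
    · have := last_case h h1 h2 h3 hu hv
      omega
  refine ⟨?_, hne⟩
  rcases hl with h1 | ⟨h1, h2⟩ | ⟨h1, h2, h3⟩ <;>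
  · simp only [walt, nx] at *
    omega

theorem Stp_eq {A B C : ℤ} {u u' : W} (h : Stp A B C u u') : u' = nx u u'.2.2 := by
  obtain ⟨h1, h2, -⟩ := h
  obtain ⟨a, b, c⟩ := u'
  simp only [nx, Prod.mk.injEq] at *
  exact ⟨h1, h2, trivial⟩

theorem Stp_between {A B C : ℤ} {u : W} {a b c : ℤ} (ha : Stp A B C u (nx u a))
    (hc : Stp A B C u (nx u c)) (h1 : a ≤ b) (h2 : b ≤ c) : Stp A B C u (nx u b) := by
  obtain ⟨-, -, h3, -⟩ := ha
  obtain ⟨-, -, -, h4⟩ := hc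
  refine ⟨rfl, rfl, ?_, ?_⟩ <;> simp only [nx] at * <;> linarith

/-- Admissible digits for a sorted triple. -/
def Ad (A B C : ℤ) (u v w : W) (a b c : ℤ) : Prop :=
  Stp A B C u (nx u a) ∧ Stp A B C v (nx v b) ∧ Stp A B C w (nx w c) ∧ c ≤ b ∧ b ≤ a ∧ a ≤ c + 1

def mk3 (u v w : W) (a b c : ℤ) : W × W × W := (nx u a, nx v b, nx w c)

def GG (A B C : ℤ) (u v w : W) : Set (W × W × W) :=
  {g | ∃ a b c, Ad A B C u v w a b c ∧ g = mk3 u v w a b c}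

theorem Gd_of_Ad {A B C : ℤ} {u v w : W} (h1 : walt u v) (h2 : walt u w) (h3 : walt v w)
    (l1 : Lt u v) (l2 : Lt u w) (l3 : Lt v w) {a b c : ℤ} (h : Ad A B C u v w a b c) :
    Gd (mk3 u v w a b c) := by
  obtain ⟨s1, s2, s3, e1, e2, e3⟩ := h
  exact ⟨pairB h1 l1 s1 s2 e2 (by omega), pairB h2 l2 s1 s3 (by omega) (by omega),
    pairB h3 l3 s2 s3 e1 (by omega)⟩

theorem GG_finite (A B C : ℤ) (u v w : W) : (GG A B C u v w).Finite := by
  have : ∀ u : W, {a : ℤ | Stp A B C u (nx u a)}.Finite := by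
    intro u
    refine (Set.finite_Icc (-(A * u.2.2 + B * u.2.1 + C * u.1))
      (C - (A * u.2.2 + B * u.2.1 + C * u.1))).subset ?_
    rintro a ⟨-, -, h1, h2⟩
    simp only [nx] at h1 h2
    constructor <;> linarith
  refine (((this u).prod ((this v).prod (this w))).image
    (fun p : ℤ × ℤ × ℤ => mk3 u v w p.1 p.2.1 p.2.2)).subset ?_
  rintro g ⟨a, b, c, h, rfl⟩
  exact ⟨(a, b, c), ⟨h.1, h.2.1, h.2.2.1⟩, rfl⟩

theorem link_up {A B C : ℤ} {T : Set E3} (hT : IsABCTile A B C T) {u v w : W}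
    (h1 : walt u v) (h2 : walt u w) (h3 : walt v w)
    (l1 : Lt u v) (l2 : Lt u w) (l3 : Lt v w) (n : ℕ) :
    ∀ a b c a' b' c', Ad A B C u v w a b c → Ad A B C u v w a' b' c' →
      a' + b' + c' = a + b + c + n →
      ReflTransGen (fun p q => p ∈ GG A B C u v w ∧ q ∈ GG A B C u v w ∧
        (Tr A B T p ∩ Tr A B T q).Nonempty) (mk3 u v w a b c) (mk3 u v w a' b' c') := by
  induction n with
  | zero =>
    intro a b c a' b' c' h h' hs
    obtain ⟨-, -, -, e1, e2, e3⟩ := h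
    obtain ⟨-, -, -, e1', e2', e3'⟩ := h'
    push_cast at hs
    have ea : a = a' := by omega
    have eb : b = b' := by omega
    have ec : c = c' := by omega
    rw [ea, eb, ec]
  | succ n ih =>
    intro a b c a' b' c' h h' hs
    have hG := Gd_of_Ad h1 h2 h3 l1 l2 l3 h
    have hwalt : ∀ (u : W) (a : ℤ), walt (nx u a) (nx u (a + 1)) := by
      intro u a
      simp only [walt, nx]
      omega
    obtain ⟨s1, s2, s3, e1, e2, e3⟩ := id h
    obtain ⟨s1', s2', s3', e1', e2', e3'⟩ := id h'
    push_cast at hs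
    by_cases hac : a = c
    · have hAd : Ad A B C u v w (a + 1) b c :=
        ⟨Stp_between s1 s1' (by omega) (by omega), s2, s3, e1, by omega, by omega⟩
      refine ReflTransGen.head ?_ (ih (a + 1) b c a' b' c' hAd h' (by omega))
      have hG' := Gd_of_Ad h1 h2 h3 l1 l2 l3 hAd
      obtain ⟨x, x1, x2, x3, x4⟩ := quad_nonempty hT hG.1.1 hG.2.1.1 (hwalt u a) hG.2.2.1
        (walt_symm hG'.1.1) (walt_symm hG'.2.1.1)
      exact ⟨⟨_, _, _, h, rfl⟩, ⟨_, _, _, hAd, rfl⟩, x, ⟨⟨x1, x2⟩, x3⟩, ⟨⟨x4, x2⟩, x3⟩⟩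
    · by_cases hbc : b = c
      · have hAd : Ad A B C u v w a (b + 1) c :=
          ⟨s1, Stp_between s2 s2' (by omega) (by omega), s3, by omega, by omega, by omega⟩
        refine ReflTransGen.head ?_ (ih a (b + 1) c a' b' c' hAd h' (by omega))
        have hG' := Gd_of_Ad h1 h2 h3 l1 l2 l3 hAd
        obtain ⟨x, x1, x2, x3, x4⟩ := quad_nonempty hT hG.1.1 hG.2.1.1 hG'.1.1 hG.2.2.1
          (hwalt v b) (walt_symm hG'.2.2.1)
        exact ⟨⟨_, _, _, h, rfl⟩, ⟨_, _, _, hAd, rfl⟩, x, ⟨⟨x1, x2⟩, x3⟩, ⟨⟨x1, x4⟩, x3⟩⟩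
      · have hAd : Ad A B C u v w a b (c + 1) :=
          ⟨s1, s2, Stp_between s3 s3' (by omega) (by omega), by omega, by omega, by omega⟩
        refine ReflTransGen.head ?_ (ih a b (c + 1) a' b' c' hAd h' (by omega))
        have hG' := Gd_of_Ad h1 h2 h3 l1 l2 l3 hAd
        obtain ⟨x, x1, x2, x3, x4⟩ := quad_nonempty hT hG.1.1 hG.2.1.1 hG'.2.1.1 hG.2.2.1
          hG'.2.2.1 (hwalt w c)
        exact ⟨⟨_, _, _, h, rfl⟩, ⟨_, _, _, hAd, rfl⟩, x, ⟨⟨x1, x2⟩, x3⟩, ⟨⟨x1, x2⟩, x4⟩⟩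

/-- The neighbor relation is the alternating relation. -/
def Hyp (A B : ℤ) (T : Set E3) : Prop :=
  ∀ u v, (Tl A B T u ∩ Tl A B T v).Nonempty → walt u v

/-- Decomposability of a set into linked triple intersections. -/
def Dec (A B C : ℤ) (T : Set E3) (K : Set E3) : Prop :=
  ∃ 𝒢 : Set (W × W × W), 𝒢.Finite ∧ (∀ g ∈ 𝒢, Gd g) ∧
    K = Fm A B C ⁻¹' (⋃ g ∈ 𝒢, Tr A B T g) ∧
    ∀ g ∈ 𝒢, ∀ g' ∈ 𝒢, ReflTransGen
      (fun p q => p ∈ 𝒢 ∧ q ∈ 𝒢 ∧ (Tr A B T p ∩ Tr A B T q).Nonempty) g g'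

theorem decomp_sorted {A B C : ℤ} {T : Set E3} (hT : IsABCTile A B C T) (H : Hyp A B T)
    {u v w : W} (h1 : walt u v) (h2 : walt u w) (h3 : walt v w)
    (l1 : Lt u v) (l2 : Lt u w) (l3 : Lt v w) : Dec A B C T (Tr A B T (u, v, w)) := by
  refine ⟨GG A B C u v w, GG_finite A B C u v w, ?_, ?_, ?_⟩
  · rintro g ⟨a, b, c, h, rfl⟩
    exact Gd_of_Ad h1 h2 h3 l1 l2 l3 h
  · ext x
    simp only [Set.mem_preimage, Set.mem_iUnion]
    constructor
    · rintro ⟨⟨hu, hv⟩, hw⟩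
      obtain ⟨u', su, hu'⟩ := (mem_Tl_iff hT _ _).1 hu
      obtain ⟨v', sv, hv'⟩ := (mem_Tl_iff hT _ _).1 hv
      obtain ⟨w', sw, hw'⟩ := (mem_Tl_iff hT _ _).1 hw
      obtain ⟨u3, rfl⟩ : ∃ a, u' = nx u a := ⟨_, Stp_eq su⟩
      obtain ⟨v3, rfl⟩ : ∃ a, v' = nx v a := ⟨_, Stp_eq sv⟩
      obtain ⟨w3, rfl⟩ : ∃ a, w' = nx w a := ⟨_, Stp_eq sw⟩
      have p1 := pairA h1 l1 su sv (H _ _ ⟨_, hu', hv'⟩)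
      have p2 := pairA h2 l2 su sw (H _ _ ⟨_, hu', hw'⟩)
      have p3 := pairA h3 l3 sv sw (H _ _ ⟨_, hv', hw'⟩)
      exact ⟨_, ⟨_, _, _, ⟨su, sv, sw, p3.1, p1.1, p2.2⟩, rfl⟩, ⟨⟨hu', hv'⟩, hw'⟩⟩
    · rintro ⟨g, ⟨a, b, c, h, rfl⟩, ⟨⟨hu, hv⟩, hw⟩⟩
      exact ⟨⟨(mem_Tl_iff hT _ _).2 ⟨_, h.1, hu⟩, (mem_Tl_iff hT _ _).2 ⟨_, h.2.1, hv⟩⟩,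
        (mem_Tl_iff hT _ _).2 ⟨_, h.2.2.1, hw⟩⟩
  · rintro g ⟨a, b, c, h, rfl⟩ g' ⟨a', b', c', h', rfl⟩
    rcases le_total (a + b + c) (a' + b' + c') with hs | hs
    · exact link_up hT h1 h2 h3 l1 l2 l3 (a' + b' + c' - (a + b + c)).toNat a b c a' b' c' h h'
        (by omega)
    · have := link_up hT h1 h2 h3 l1 l2 l3 (a + b + c - (a' + b' + c')).toNat a' b' c' a b c h' h
        (by omega)
      rw [← reflTransGen_swap] at this
      refine ReflTransGen.mono ?_ _ _ this
      rintro p q ⟨hp, hq, hne⟩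
      exact ⟨hq, hp, by rwa [Set.inter_comm]⟩

theorem decomp {A B C : ℤ} {T : Set E3} (hT : IsABCTile A B C T) (H : Hyp A B T)
    {t : W × W × W} (ht : Gd t) : Dec A B C T (Tr A B T t) := by
  obtain ⟨u, v, w⟩ := t
  obtain ⟨⟨h1, n1⟩, ⟨h2, n2⟩, ⟨h3, n3⟩⟩ := ht
  simp only at h1 n1 h2 n2 h3 n3
  have key : ∀ x y z : W, Tr A B T (x, y, z) = Tr A B T (u, v, w) → walt x y → walt x z →
      walt y z → Lt x y → Lt x z → Lt y z → Dec A B C T (Tr A B T (u, v, w)) := by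
    intro x y z e a1 a2 a3 b1 b2 b3
    rw [← e]
    exact decomp_sorted hT H a1 a2 a3 b1 b2 b3
  have tr : ∀ {x y z : W}, Lt x y → Lt y z → Lt x z := by
    intro x y z a b
    unfold Lt at *
    omega
  have g1 := walt_symm h1
  have g2 := walt_symm h2
  have g3 := walt_symm h3
  rcases Lt_total n1 with a | a <;> rcases Lt_total n2 with b | b <;> rcases Lt_total n3 with c | c
  · exact key u v w rfl h1 h2 h3 a b c
  · exact key u w v (by ext; simp only [Tr, Set.mem_inter_iff]; tauto) h2 h1 g3 b a c
  · exact key w u v (by ext; simp only [Tr, Set.mem_inter_iff]; tauto) g2 g3 h1 b (tr b a) a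
  · exact key w u v (by ext; simp only [Tr, Set.mem_inter_iff]; tauto) g2 g3 h1 b c a
  · exact key v u w (by ext; simp only [Tr, Set.mem_inter_iff]; tauto) g1 h3 h2 a c b
  · exact key v u w (by ext; simp only [Tr, Set.mem_inter_iff]; tauto) g1 h3 h2 a (tr a b) b
  · exact key v w u (by ext; simp only [Tr, Set.mem_inter_iff]; tauto) h3 g1 g2 c a b
  · exact key w v u (by ext; simp only [Tr, Set.mem_inter_iff]; tauto) g3 g2 g1 c b a

theorem isCompact_Tr {A B C : ℤ} {T : Set E3} (hT : IsABCTile A B C T) (t : W × W × W) :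
    IsCompact (Tr A B T t) :=
  ((isCompact_Tl hT _).inter (isCompact_Tl hT _)).inter (isCompact_Tl hT _)

theorem chn_all {A B C : ℤ} {T : Set E3} (hT : IsABCTile A B C T) (H : Hyp A B T) {R : ℝ}
    (hR : ∀ u, ∀ x ∈ Tl A B T u, ∀ y ∈ Tl A B T u, y - x ∈ Vn A B C R 0) (n : ℕ) :
    ∀ t, Gd t → Chn (Vn A B C R n) (Tr A B T t) := by
  have hC : 0 < C := by have := hT.1; have := hT.2.1; have := hT.2.2.1; omega
  induction n with
  | zero =>
    intro t _ x hx y hy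
    exact ReflTransGen.single ⟨hx, hy, hR _ x hx.1.1 y hy.1.1⟩
  | succ n ih =>
    intro t ht
    obtain ⟨𝒢, -, hG, hK, hl⟩ := decomp hT H ht
    have := chn_preimage (A := A) (B := B) hC
      (chn_iUnion 𝒢 (Tr A B T) (fun g hg => ih g (hG g hg)) hl)
    rw [hK]
    have e : Vn A B C R (n + 1) = Fm A B C ⁻¹' Vn A B C R n := by
      ext x; exact mem_Vn_succ A B C R n x
    rw [e]
    exact this

theorem preconn_Tr {A B C : ℤ} {T : Set E3} (hT : IsABCTile A B C T) (H : Hyp A B T)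
    (t : W × W × W) (ht : Gd t) : IsPreconnected (Tr A B T t) := by
  obtain ⟨R, hR, -⟩ := exists_R hT
  refine preconn_of_chn (isCompact_Tr hT t) fun ε hε => ?_
  obtain ⟨N, hN⟩ := Vn_small hT.1 hT.2.1 hT.2.2.1 R ε hε
  exact ⟨_, hN N le_rfl, chn_all hT H hR _ t ht⟩

theorem cover_Tr {A B C : ℤ} {T : Set E3} (hT : IsABCTile A B C T) (H : Hyp A B T) {R : ℝ}
    (hR : ∀ u, ∀ x ∈ Tl A B T u, ∀ y ∈ Tl A B T u, y - x ∈ Vn A B C R 0) (n : ℕ) :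
    ∀ t, Gd t → ∃ 𝒦 : Set (Set E3), 𝒦.Finite ∧ ⋃₀ 𝒦 = Tr A B T t ∧
      ∀ K ∈ 𝒦, IsCompact K ∧ IsPreconnected K ∧ ∀ x ∈ K, ∀ y ∈ K, y - x ∈ Vn A B C R n := by
  have hC : 0 < C := by have := hT.1; have := hT.2.1; have := hT.2.2.1; omega
  induction n with
  | zero =>
    intro t ht
    refine ⟨{Tr A B T t}, Set.finite_singleton _, Set.sUnion_singleton _, ?_⟩
    rintro K rfl
    exact ⟨isCompact_Tr hT t, preconn_Tr hT H t ht, fun x hx y hy => hR _ x hx.1.1 y hy.1.1⟩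
  | succ n ih =>
    intro t ht
    obtain ⟨𝒢, hfin, hG, hK, -⟩ := decomp hT H ht
    choose! 𝒦 h1 h2 h3 using ih
    refine ⟨⋃ g ∈ 𝒢, (fun K => Fm A B C ⁻¹' K) '' 𝒦 g, ?_, ?_, ?_⟩
    · exact hfin.biUnion fun g hg => (h1 g (hG g hg)).image _
    · rw [hK]
      ext x
      simp only [Set.mem_sUnion, Set.mem_iUnion, Set.mem_image, Set.mem_preimage]
      constructor
      · rintro ⟨_, ⟨g, hg, K, hKg, rfl⟩, hx⟩
        refine ⟨g, hg, ?_⟩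
        rw [← h2 g (hG g hg)]
        exact ⟨K, hKg, hx⟩
      · rintro ⟨g, hg, hx⟩
        rw [← h2 g (hG g hg)] at hx
        obtain ⟨K, hKg, hx⟩ := hx
        exact ⟨_, ⟨g, hg, K, hKg, rfl⟩, hx⟩
    · intro K' hK'
      simp only [Set.mem_iUnion, Set.mem_image] at hK'
      obtain ⟨g, hg, K, hKg, rfl⟩ := hK'
      obtain ⟨k1, k2, k3⟩ := h3 g (hG g hg) K hKg
      refine ⟨?_, ?_, ?_⟩
      · rw [preimage_eq hC]
        exact k1.image (continuous_Gm A B C)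
      · rw [preimage_eq hC]
        exact k2.image _ (continuous_Gm A B C).continuousOn
      · intro x hx y hy
        rw [mem_Vn_succ, Fm_sub]
        exact k3 _ hx _ hy

end ABC

namespace ABC

open Relation

/-- The fourteen alternating windows. -/
def S14 : Finset W :=
  {(1,0,0), (0,1,0), (0,0,1), (1,-1,0), (0,1,-1), (1,0,-1), (1,-1,1),
    (-1,0,0), (0,-1,0), (0,0,-1), (-1,1,0), (0,-1,1), (-1,0,1), (-1,1,-1)}

instance : DecidableRel adj := fun u v => by unfold adj; infer_instance

theorem mem_S14 {u : W} : u ∈ S14 ↔ adj (0, 0, 0) u := by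
  constructor
  · revert u
    decide +kernel
  · rintro ⟨h, hne⟩
    have := walt_cases u.1 u.2.1 u.2.2 h
    rw [List.mem_cons] at this
    rcases this with h0 | h0
    · exact absurd h0.symm hne
    · simpa [S14] using h0

theorem hub : ∀ a ∈ S14, ∃ h ∈ S14, adj a h ∧ ∀ b ∈ S14, adj a b →
    ∃ p ∈ S14, adj a p ∧ walt b p ∧ ∃ q ∈ S14, adj a q ∧ walt p q ∧ walt q h := by
  decide +kernel

/-- Adapted coordinates of a lattice point. -/
def co (A B : ℤ) (α : Fin 3 → ℤ) : W :=
  (α 2, α 1 - A * α 2, α 0 - A * (α 1 - A * α 2) - B * α 2)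

theorem Ph_co (A B : ℤ) (α : Fin 3 → ℤ) : Ph A B (co A B α) = α := by
  ext i
  fin_cases i <;> simp [Ph, co]
  ring

theorem co_Ph (A B : ℤ) (u : W) : co A B (Ph A B u) = u := by
  obtain ⟨a, b, c⟩ := u
  simp [Ph, co]
  ring

theorem Ph_zero (A B : ℤ) : Ph A B (0, 0, 0) = 0 := by
  ext i
  fin_cases i <;> simp [Ph]

theorem tileTranslate_eq (A B : ℤ) (T : Set E3) (u : W) :
    tileTranslate (toR (Ph A B u)) T = Tl A B T u := by
  ext x
  simp only [tileTranslate, Tl, Set.mem_ofPred_eq, Set.mem_image]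
  exact ⟨by rintro ⟨y, hy, rfl⟩; simpa using hy, fun h => ⟨_, h, by simp⟩⟩

theorem Tl_zero (A B : ℤ) (T : Set E3) : Tl A B T (0, 0, 0) = T := by
  ext x
  simp only [Tl, Ph_zero, Set.mem_ofPred_eq]
  have : toR 0 = 0 := by ext i; simp [toR]
  rw [this, sub_zero]

theorem Neighbors_eq {A B C : ℤ} {T : Set E3} (hT : IsABCTile A B C T)
    (h14 : (Neighbors T).ncard = 14) : Ph A B '' (S14 : Set W) = Neighbors T := by
  have hinj : Function.Injective (Ph A B) := Function.LeftInverse.injective (co_Ph A B)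
  refine Set.eq_of_subset_of_ncard_le ?_ ?_ (Set.finite_of_ncard_ne_zero (by omega))
  · rintro _ ⟨u, hu, rfl⟩
    have hu' := mem_S14.1 hu
    refine ⟨?_, ?_⟩
    · rw [← Ph_zero A B]
      exact fun h => hu'.2 (hinj h).symm
    · obtain ⟨x, x1, x2, -⟩ := quad_nonempty hT hu'.1 (walt_refl _) (walt_refl _)
        (walt_symm hu'.1) (walt_symm hu'.1) (walt_refl _)
      rw [tileTranslate_eq]
      rw [Tl_zero] at x1
      exact ⟨x, x1, x2⟩
  · rw [h14, Set.ncard_image_of_injective _ hinj, Set.ncard_coe_finset]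
    decide

theorem hyp_of_14 {A B C : ℤ} {T : Set E3} (hT : IsABCTile A B C T)
    (h14 : (Neighbors T).ncard = 14) : Hyp A B T := by
  rintro u v ⟨x, hu, hv⟩
  by_cases huv : u = v
  · rw [huv]; exact walt_refl v
  set d : W := (v.1 - u.1, v.2.1 - u.2.1, v.2.2 - u.2.2) with hd
  have hd0 : d ≠ (0, 0, 0) := by
    intro h
    apply huv
    obtain ⟨a, b, c⟩ := u
    obtain ⟨a', b', c'⟩ := v
    simp only [hd, Prod.mk.injEq] at h ⊢
    omega
  have hn : Ph A B d ∈ Neighbors T := by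
    refine ⟨?_, x - toR (Ph A B u), hu, ?_⟩
    · intro h
      rw [← Ph_zero A B] at h
      exact hd0 (Function.LeftInverse.injective (co_Ph A B) h)
    · rw [tileTranslate_eq]
      have hv' : x - toR (Ph A B v) ∈ T := hv
      have : x - toR (Ph A B u) - toR (Ph A B d) ∈ T := by
        rw [hd, ← toR_sub]
        convert hv' using 1
        abel
      exact this
  rw [← Neighbors_eq hT h14] at hn
  obtain ⟨e, he, heq⟩ := hn
  have := Function.LeftInverse.injective (co_Ph A B) heq
  subst this
  have := (mem_S14.1 he).1
  simpa [walt, hd] using this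

/-- The index set of the triple intersections in `L_α`. -/
def Nb (a : W) : Set W := {b | adj (0, 0, 0) b ∧ adj a b}

theorem peano {A B C : ℤ} {T : Set E3} (hT : IsABCTile A B C T)
    (h14 : (Neighbors T).ncard = 14) (a : W) (ha : adj (0, 0, 0) a) (L : Set E3)
    (hL : L = ⋃ b ∈ Nb a, Tr A B T ((0, 0, 0), a, b)) :
    IsCompact L ∧ IsConnected L ∧ LocallyConnectedSpace L := by
  have H := hyp_of_14 hT h14
  have hfin : (Nb a).Finite := S14.finite_toSet.subset fun b hb => mem_S14.2 hb.1
  have hGd : ∀ b ∈ Nb a, Gd ((0, 0, 0), a, b) := fun b hb => ⟨ha, hb.1, hb.2⟩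
  obtain ⟨h, hh, hah, hpath⟩ := hub a (mem_S14.2 ha)
  rw [mem_S14] at hh
  subst hL
  have hlink : ∀ b c, b ∈ Nb a → c ∈ Nb a → walt b c →
      (Tr A B T ((0, 0, 0), a, b) ∩ Tr A B T ((0, 0, 0), a, c)).Nonempty := by
    intro b c hb hc hbc
    obtain ⟨x, x1, x2, x3, x4⟩ := quad_nonempty hT ha.1 hb.1.1 hc.1.1 hb.2.1 hc.2.1 hbc
    exact ⟨x, ⟨⟨x1, x2⟩, x3⟩, ⟨⟨x1, x2⟩, x4⟩⟩
  refine ⟨hfin.isCompact_biUnion fun b _ => isCompact_Tr hT _, ⟨?_, ?_⟩, ?_⟩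
  · obtain ⟨x, hx, -⟩ := hlink h h ⟨hh, hah⟩ ⟨hh, hah⟩ (walt_refl _)
    exact ⟨x, Set.mem_biUnion (show h ∈ Nb a from ⟨hh, hah⟩) hx⟩
  · refine IsPreconnected.biUnion_of_reflTransGen (fun b hb => preconn_Tr hT H _ (hGd b hb)) ?_
    have h1 : ∀ b ∈ Nb a, ∃ p ∈ Nb a, ∃ q ∈ Nb a, walt b p ∧ walt p q ∧ walt q h := by
      intro b hb
      obtain ⟨p, hp, hap, hbp, q, hq, haq, hpq, hqh⟩ := hpath b (mem_S14.2 hb.1) hb.2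
      exact ⟨p, ⟨mem_S14.1 hp, hap⟩, q, ⟨mem_S14.1 hq, haq⟩, hbp, hpq, hqh⟩
    intro b hb c hc
    obtain ⟨p, hp, q, hq, e1, e2, e3⟩ := h1 b hb
    obtain ⟨p', hp', q', hq', e1', e2', e3'⟩ := h1 c hc
    have hH : h ∈ Nb a := ⟨hh, hah⟩
    exact ((((((ReflTransGen.single ⟨hlink _ _ hb hp e1, hb⟩).tail
      ⟨hlink _ _ hp hq e2, hp⟩).tail ⟨hlink _ _ hq hH e3, hq⟩).tail
      ⟨hlink _ _ hH hq' (walt_symm e3'), hH⟩).tail ⟨hlink _ _ hq' hp' (walt_symm e2'), hq'⟩).tail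
      ⟨hlink _ _ hp' hc (walt_symm e1'), hp'⟩)
  · refine locConn_of_cover _ fun ε hε => ?_
    obtain ⟨R, hR, -⟩ := exists_R hT
    obtain ⟨N, hN⟩ := Vn_small hT.1 hT.2.1 hT.2.2.1 R ε hε
    choose! 𝒦 h1 h2 h3 using cover_Tr hT H hR (11 * N)
    refine ⟨⋃ b ∈ Nb a, 𝒦 ((0, 0, 0), a, b), ?_, ?_, ?_⟩
    · exact hfin.biUnion fun b hb => h1 _ (hGd b hb)
    · rw [Set.sUnion_iUnion]
      refine Set.iUnion_congr fun b => ?_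
      rw [Set.sUnion_iUnion]
      exact Set.iUnion_congr fun hb => h2 _ (hGd b hb)
    · intro K hK
      simp only [Set.mem_iUnion] at hK
      obtain ⟨b, hb, hK⟩ := hK
      obtain ⟨k1, k2, k3⟩ := h3 _ (hGd b hb) K hK
      refine ⟨k1, k2, fun x hx y hy => ?_⟩
      rw [dist_comm, dist_eq_norm]
      exact hN N le_rfl _ (k3 x hx y hy)

theorem L_eq {A B C : ℤ} {T : Set E3} (hT : IsABCTile A B C T)
    (h14 : (Neighbors T).ncard = 14) (a : W) :
    (⋃ β ∈ {β : Fin 3 → ℤ | β ∉ ({0, Ph A B a} : Set (Fin 3 → ℤ))},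
      T ∩ tileTranslate (toR (Ph A B a)) T ∩ tileTranslate (toR β) T) =
    ⋃ b ∈ Nb a, Tr A B T ((0, 0, 0), a, b) := by
  have H := hyp_of_14 hT h14
  have hinj : Function.Injective (Ph A B) := Function.LeftInverse.injective (co_Ph A B)
  ext x
  simp only [Set.mem_iUnion]
  constructor
  · rintro ⟨β, hβ, hx⟩
    rw [← Ph_co A B β] at hβ hx
    rw [tileTranslate_eq, tileTranslate_eq] at hx
    obtain ⟨⟨x1, x2⟩, x3⟩ := hx
    rw [← Tl_zero A B T] at x1
    simp only [Set.mem_ofPred_eq, Set.mem_insert_iff, Set.mem_singleton_iff, not_or] at hβ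
    refine ⟨co A B β, ⟨⟨H _ _ ⟨x, x1, x3⟩, ?_⟩, ⟨H _ _ ⟨x, x2, x3⟩, ?_⟩⟩, ⟨⟨x1, x2⟩, x3⟩⟩
    · intro h
      rw [← h] at hβ
      exact hβ.1 (Ph_zero A B)
    · intro h
      rw [← h] at hβ
      exact hβ.2 rfl
  · rintro ⟨b, hb, ⟨⟨x1, x2⟩, x3⟩⟩
    refine ⟨Ph A B b, ?_, ?_⟩
    · simp only [Set.mem_ofPred_eq, Set.mem_insert_iff, Set.mem_singleton_iff, not_or]
      refine ⟨?_, fun h => hb.2.2 (hinj h).symm⟩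
      rw [← Ph_zero A B]
      exact fun h => hb.1.2 (hinj h).symm
    · rw [tileTranslate_eq, tileTranslate_eq]
      rw [Tl_zero] at x1
      exact ⟨⟨x1, x2⟩, x3⟩

end ABC

theorem stmt15 (A B C : ℤ) (T : Set (Fin 3 → ℝ)) (hT : IsABCTile A B C T)
    (h14 : (Neighbors T).ncard = 14) (α : Fin 3 → ℤ) (hα : α ∈ Neighbors T) :
    IsCompact (⋃ β ∈ {β : Fin 3 → ℤ | β ∉ ({0, α} : Set (Fin 3 → ℤ))},
      T ∩ tileTranslate (toR α) T ∩ tileTranslate (toR β) T) ∧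
    IsConnected (⋃ β ∈ {β : Fin 3 → ℤ | β ∉ ({0, α} : Set (Fin 3 → ℤ))},
      T ∩ tileTranslate (toR α) T ∩ tileTranslate (toR β) T) ∧
    LocallyConnectedSpace ((⋃ β ∈ {β : Fin 3 → ℤ | β ∉ ({0, α} : Set (Fin 3 → ℤ))},
      T ∩ tileTranslate (toR α) T ∩ tileTranslate (toR β) T) : Set (Fin 3 → ℝ)) := by
  have hα' := hα
  rw [← ABC.Neighbors_eq hT h14] at hα'
  obtain ⟨a, ha, rfl⟩ := hα'
  exact ABC.peano hT h14 a (ABC.mem_S14.1 ha) _ (ABC.L_eq hT h14 a)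
end
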